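/- (Interior Schauder estimate.) Let n ≥ 1, σ ∈ (0,1), k ∈ ℕ ∪ {0}, α ∈ (0,1) with α + 2σ not an integer. Let u ∈ L_σ(ℝⁿ) and let f : B₂(0) → ℝ be of class C^{k,α} with finite C^{k,α}(B₂) norm, such that ∫_{ℝⁿ} u(x)·((−Δ)^σφ)(x) dx = ∫_{ℝⁿ} f(x) φ(x) dx for every φ ∈ C_c^∞(B₂(0)). Then u agrees almost everywhere on B₁(0) with a function of class C^{k,α+2σ}(B₁(0)) (with the convention C^{k,β} = C^{k+1,β−1} when β > 1), and there exists a constant C = C(n,σ,k) > 0, independent of u and f, such that ‖u‖_{C^{k,α+2σ}(B₁)} ≤ C·( ∫_{ℝⁿ} |u(x)|/(1+|x|^{n+2σ}) dx + ‖f‖_{C^{k,α}(B₂)} ). -/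

import Mathlib

open MeasureTheory Real Filter

noncomputable section

/-- The normalizing constant `c_{n,σ} = 4^σ Γ(n/2+σ)/(π^{n/2}|Γ(−σ)|)` of the fractional
Laplacian. -/
def fracConst (n : ℕ) (σ : ℝ) : ℝ :=
  (4 : ℝ) ^ σ * Real.Gamma ((n : ℝ) / 2 + σ) / (Real.pi ^ ((n : ℝ) / 2) * |Real.Gamma (-σ)|)

/-- The fractional Laplacian `(−Δ)^σ φ` of a function on ℝⁿ, defined as a principal value:
`c_{n,σ} lim_{ε→0⁺} ∫_{|x−y|>ε} (φ(x)−φ(y))/|x−y|^{n+2σ} dy`. -/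
def fracLap (n : ℕ) (σ : ℝ) (φ : EuclideanSpace ℝ (Fin n) → ℝ)
    (x : EuclideanSpace ℝ (Fin n)) : ℝ :=
  fracConst n σ * limUnder (nhdsWithin (0:ℝ) (Set.Ioi 0)) fun ε =>
    ∫ y in {y : EuclideanSpace ℝ (Fin n) | ε < ‖x - y‖},
      (φ x - φ y) / ‖x - y‖ ^ ((n : ℝ) + 2 * σ)

/-- `u ∈ L_σ(ℝⁿ)`. -/
def MemLσ (n : ℕ) (σ : ℝ) (u : EuclideanSpace ℝ (Fin n) → ℝ) : Prop :=
  LocallyIntegrable u volume ∧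
    Integrable (fun x => |u x| / (1 + ‖x‖ ^ ((n : ℝ) + 2 * σ))) volume

end

noncomputable section

/-- `g` is in the Hölder class `C^{k,β}(Ω)` with norm at most `M`: all derivatives up to
order `k` are bounded by `M` on `Ω` and the `k`-th derivative has `β`-Hölder constant at
most `M` on `Ω`. -/
def HolderBdd (n : ℕ) (k : ℕ) (β : ℝ) (Ω : Set (EuclideanSpace ℝ (Fin n)))
    (g : EuclideanSpace ℝ (Fin n) → ℝ) (M : ℝ) : Prop :=
  (∀ j ≤ k, ∀ x ∈ Ω, ‖iteratedFDerivWithin ℝ j g Ω x‖ ≤ M) ∧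
  ∀ x ∈ Ω, ∀ y ∈ Ω,
    ‖iteratedFDerivWithin ℝ k g Ω x - iteratedFDerivWithin ℝ k g Ω y‖ ≤ M * ‖x - y‖ ^ β

end

section ParametricIntegral

variable {A E F : Type*} [MeasurableSpace A] [NormedAddCommGroup E] [NormedSpace ℝ E]
  [NormedAddCommGroup F] [NormedSpace ℝ F] [CompleteSpace F]

/-- A parametric integral whose integrand has dominated derivatives up to order `m` on an open set
has the integrals of these derivatives as its Taylor series. -/
theorem hasFTaylorSeriesUpToOn_integral {μ : Measure A} {s : Set E} (hs : IsOpen s) {m : ℕ}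
    {f : A → E → F} {bound : ℕ → A → ℝ} (hf : ∀ a, ContDiffOn ℝ m (f a) s)
    (hmeas : ∀ j ≤ m, ∀ x ∈ s, AEStronglyMeasurable (fun a => iteratedFDeriv ℝ j (f a) x) μ)
    (hint : ∀ j ≤ m, Integrable (bound j) μ)
    (hbound : ∀ j ≤ m, ∀ᵐ a ∂μ, ∀ x ∈ s, ‖iteratedFDeriv ℝ j (f a) x‖ ≤ bound j a) :
    HasFTaylorSeriesUpToOn m (fun x => ∫ a, f a x ∂μ)
      (fun x j => ∫ a, iteratedFDeriv ℝ j (f a) x ∂μ) s := by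
  have hI : ∀ j ≤ m, ∀ x ∈ s, Integrable (fun a => iteratedFDeriv ℝ j (f a) x) μ := by
    intro j hj x hx
    refine (hint j hj).mono' (hmeas j hj x hx) ?_
    filter_upwards [hbound j hj] with a ha using ha x hx
  refine ⟨fun x hx => ?_, fun j hj x hx => ?_, fun j hj => ?_⟩
  · have := ContinuousLinearMap.integral_comp_comm
      ((continuousMultilinearCurryFin0 ℝ E F).toContinuousLinearEquiv.toContinuousLinearMap)
      (hI 0 (Nat.zero_le _) x hx)
    simpa using this.symm
  · have hj' : j < m := by exact_mod_cast hj
    have key : HasFDerivAt (fun x => ∫ a, iteratedFDeriv ℝ j (f a) x ∂μ)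
        (∫ a, (iteratedFDeriv ℝ (j + 1) (f a) x).curryLeft ∂μ) x := by
      refine hasFDerivAt_integral_of_dominated_of_fderiv_le (𝕜 := ℝ) (bound := bound (j + 1))
        (F' := fun x a => (iteratedFDeriv ℝ (j + 1) (f a) x).curryLeft)
        (hs.mem_nhds hx) ?_ (hI j hj'.le x hx) ?_ ?_ (hint _ hj') ?_
      · filter_upwards [hs.mem_nhds hx] with y hy using hmeas j hj'.le y hy
      · exact (continuousMultilinearCurryLeftEquiv ℝ (fun _ : Fin (j + 1) => E)
          F).continuous.comp_aestronglyMeasurable (hmeas (j + 1) hj' x hx)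
      · filter_upwards [hbound (j + 1) hj'] with a ha y hy
        simpa using ha y hy
      · refine Eventually.of_forall fun a y hy => ?_
        have h1 := ((hf a).contDiffAt (hs.mem_nhds hy)).differentiableAt_iteratedFDeriv
          (m := j) (by exact_mod_cast hj')
        have h2 := h1.hasFDerivAt
        rw [fderiv_iteratedFDeriv] at h2
        exact h2
    let L : (E [×(j + 1)]→L[ℝ] F) →L[ℝ] (E →L[ℝ] E [×j]→L[ℝ] F) :=
      (continuousMultilinearCurryLeftEquiv ℝ (fun _ : Fin (j + 1) => E)
          F).toContinuousLinearEquiv.toContinuousLinearMap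
    have h3 := ContinuousLinearMap.integral_comp_comm (𝕜 := ℝ) (Fₗ := E →L[ℝ] E [×j]→L[ℝ] F) L (hI (j + 1) hj' x hx)
    have h4 : ∫ a, (iteratedFDeriv ℝ (j + 1) (f a) x).curryLeft ∂μ =
        (∫ a, iteratedFDeriv ℝ (j + 1) (f a) x ∂μ).curryLeft := h3
    rw [h4] at key
    exact key.hasFDerivWithinAt
  · have hj' : j ≤ m := by exact_mod_cast hj
    refine continuousOn_of_dominated (bound := bound j) (fun x hx => hmeas j hj' x hx) ?_
      (hint j hj') ?_
    · intro x hx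
      filter_upwards [hbound j hj'] with a ha using ha x hx
    · refine Eventually.of_forall fun a x hx => ?_
      exact (((hf a).contDiffAt (hs.mem_nhds hx)).continuousAt_iteratedFDeriv
          (by exact_mod_cast hj')).continuousWithinAt

theorem iteratedFDeriv_integral {μ : Measure A} {s : Set E} (hs : IsOpen s) {m : ℕ}
    {f : A → E → F} {bound : ℕ → A → ℝ} (hf : ∀ a, ContDiffOn ℝ m (f a) s)
    (hmeas : ∀ j ≤ m, ∀ x ∈ s, AEStronglyMeasurable (fun a => iteratedFDeriv ℝ j (f a) x) μ)
    (hint : ∀ j ≤ m, Integrable (bound j) μ)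
    (hbound : ∀ j ≤ m, ∀ᵐ a ∂μ, ∀ x ∈ s, ‖iteratedFDeriv ℝ j (f a) x‖ ≤ bound j a)
    {j : ℕ} (hj : j ≤ m) {x : E} (hx : x ∈ s) :
    iteratedFDeriv ℝ j (fun x => ∫ a, f a x ∂μ) x = ∫ a, iteratedFDeriv ℝ j (f a) x ∂μ := by
  rw [← iteratedFDerivWithin_of_isOpen j hs hx]
  exact ((hasFTaylorSeriesUpToOn_integral hs hf hmeas hint hbound).eq_iteratedFDerivWithin_of_uniqueDiffOn
    (by exact_mod_cast hj) hs.uniqueDiffOn hx).symm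

theorem contDiffOn_integral {μ : Measure A} {s : Set E} (hs : IsOpen s) {m : ℕ}
    {f : A → E → F} {bound : ℕ → A → ℝ} (hf : ∀ a, ContDiffOn ℝ m (f a) s)
    (hmeas : ∀ j ≤ m, ∀ x ∈ s, AEStronglyMeasurable (fun a => iteratedFDeriv ℝ j (f a) x) μ)
    (hint : ∀ j ≤ m, Integrable (bound j) μ)
    (hbound : ∀ j ≤ m, ∀ᵐ a ∂μ, ∀ x ∈ s, ‖iteratedFDeriv ℝ j (f a) x‖ ≤ bound j a) :
    ContDiffOn ℝ m (fun x => ∫ a, f a x ∂μ) s :=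
  (hasFTaylorSeriesUpToOn_integral hs hf hmeas hint hbound).contDiffOn

end ParametricIntegral

/-- The Euclidean space `ℝⁿ`. -/
abbrev Euc (n : ℕ) := EuclideanSpace ℝ (Fin n)

/-- The symmetric second difference of `g` at `x` in direction `z`. -/
def secondDiff {E F : Type*} [AddCommGroup E] [AddCommGroup F] [Module ℝ F]
    (g : E → F) (x z : E) : F :=
  (2 : ℝ) • g x - g (x + z) - g (x - z)

/-- The unnormalized fractional Laplacian, as an absolutely convergent integral of second
differences. -/
noncomputable def fracOp {F : Type*} [NormedAddCommGroup F] [NormedSpace ℝ F] (n : ℕ) (σ : ℝ)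
    (g : Euc n → F) (x : Euc n) : F :=
  ∫ z : Euc n, ‖z‖ ^ (-((n : ℝ) + 2 * σ)) • secondDiff g x z

theorem integrable_min_one_sq_mul_rpow {n : ℕ} (hn : 1 ≤ n) {σ : ℝ} (hσ : σ ∈ Set.Ioo (0 : ℝ) 1) :
    Integrable (fun z : Euc n => min 1 (‖z‖ ^ 2) * ‖z‖ ^ (-((n : ℝ) + 2 * σ))) := by
  have : NeZero n := ⟨by omega⟩
  have : Nontrivial (Euc n) := inferInstance
  obtain ⟨h0, h1⟩ := hσ
  rw [integrable_fun_norm_addHaar volume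
    (f := fun r : ℝ => min 1 (r ^ 2) * r ^ (-((n : ℝ) + 2 * σ)))]
  simp only [finrank_euclideanSpace, Fintype.card_fin, smul_eq_mul]
  have hpow : ∀ r : ℝ, 0 < r → ∀ a : ℝ, r ^ (n - 1) * (r ^ a * r ^ (-((n : ℝ) + 2 * σ))) =
      r ^ (a - 1 - 2 * σ) := by
    intro r hr a
    rw [← rpow_natCast r (n - 1), ← rpow_add hr, ← rpow_add hr, Nat.cast_sub hn]
    congr 1
    push_cast
    ring
  rw [← Set.Ioc_union_Ioi_eq_Ioi zero_le_one]
  refine IntegrableOn.union ?_ ?_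
  · have h : IntegrableOn (fun r : ℝ => r ^ (2 - 1 - 2 * σ)) (Set.Ioc 0 1) := by
      have := intervalIntegral.intervalIntegrable_rpow' (a := 0) (b := 1)
        (r := 2 - 1 - 2 * σ) (by linarith)
      rwa [intervalIntegrable_iff_integrableOn_Ioc_of_le zero_le_one] at this
    refine h.congr_fun (fun r hr => ?_) measurableSet_Ioc
    have hr2 : r ^ 2 ≤ 1 := pow_le_one₀ hr.1.le hr.2
    have := hpow r hr.1 2
    simp only [min_eq_right hr2]
    rw [← this]
    norm_num
  · have h : IntegrableOn (fun r : ℝ => r ^ (0 - 1 - 2 * σ)) (Set.Ioi 1) :=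
      integrableOn_Ioi_rpow_of_lt (by linarith) one_pos
    refine h.congr_fun (fun r (hr : 1 < r) => ?_) measurableSet_Ioi
    have hr2 : 1 ≤ r ^ 2 := one_le_pow₀ hr.le
    have := hpow r (by linarith) 0
    simp only [min_eq_left hr2]
    rw [← this]
    norm_num

theorem continuous_secondDiff_right {E F : Type*} [NormedAddCommGroup E]
    [NormedAddCommGroup F] [NormedSpace ℝ F] {g : E → F} (hg : Continuous g) (x : E) :
    Continuous (fun z => secondDiff g x z) := by
  unfold secondDiff; fun_prop

section Operator

variable {E F : Type*} [NormedAddCommGroup E] [NormedSpace ℝ E]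
  [NormedAddCommGroup F] [NormedSpace ℝ F]

theorem exists_norm_le_of_hasCompactSupport {X G : Type*} [TopologicalSpace X]
    [NormedAddCommGroup G] {g : X → G} (hg : Continuous g) (hc : HasCompactSupport g) :
    ∃ B : ℝ, 0 ≤ B ∧ ∀ x, ‖g x‖ ≤ B := by
  obtain ⟨B, hB⟩ := hg.bounded_above_of_compact_support hc
  exact ⟨max B 0, le_max_right _ _, fun x => (hB x).trans (le_max_left _ _)⟩

theorem exists_norm_secondDiff_le {g : E → F} (hg : ContDiff ℝ 2 g) (hc : HasCompactSupport g) :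
    ∃ B : ℝ, 0 ≤ B ∧ ∀ x z, ‖secondDiff g x z‖ ≤ B * min 1 (‖z‖ ^ 2) := by
  have hg1 : ContDiff ℝ 1 (fderiv ℝ g) := hg.fderiv_right (by norm_num)
  obtain ⟨B0, hB0', hB0⟩ := exists_norm_le_of_hasCompactSupport hg.continuous hc
  obtain ⟨L, hL⟩ := hg1.lipschitzWith_of_hasCompactSupport (hc.fderiv (𝕜 := ℝ)) one_ne_zero
  obtain ⟨B2, hB2', hlip⟩ : ∃ B2 : ℝ, 0 ≤ B2 ∧
      ∀ x z, ‖fderiv ℝ g (x + z) - fderiv ℝ g x‖ ≤ B2 * ‖z‖ := by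
    refine ⟨L, L.2, fun x z => ?_⟩
    simpa using hL.norm_sub_le (x + z) x
  have hd : Differentiable ℝ g := hg.differentiable (by norm_num)
  refine ⟨4 * B0 + B2, by positivity, fun x z => ?_⟩
  rcases le_total 1 (‖z‖ ^ 2) with h | h
  · rw [min_eq_left h, secondDiff]
    calc ‖(2 : ℝ) • g x - g (x + z) - g (x - z)‖
        ≤ ‖(2 : ℝ) • g x‖ + ‖g (x + z)‖ + ‖g (x - z)‖ :=
          (norm_sub_le _ _).trans (by gcongr; exact norm_sub_le _ _)
      _ ≤ 2 * B0 + B0 + B0 := by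
          gcongr
          · rw [norm_smul]; norm_num; exact hB0 x
          · exact hB0 _
          · exact hB0 _
      _ ≤ _ := by linarith
  · rw [min_eq_right h]
    have := Convex.norm_image_sub_le_of_norm_fderiv_le (𝕜 := ℝ) (s := Set.univ) (C := B2 * ‖z‖)
      (f := fun w => g (w + z) - g w) (fun y _ => by fun_prop) (fun y _ => ?_) convex_univ
      (Set.mem_univ (x - z)) (Set.mem_univ x)
    · have e : secondDiff g x z = -((g (x + z) - g x) - (g (x - z + z) - g (x - z))) := by
        simp only [secondDiff, sub_add_cancel, two_smul]
        abel
      rw [e, norm_neg]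
      calc _ ≤ _ := this
        _ = B2 * ‖z‖ ^ 2 := by rw [sub_sub_cancel]; ring
        _ ≤ _ := by nlinarith [sq_nonneg ‖z‖]
    · rw [fderiv_fun_sub (by fun_prop) (by fun_prop), fderiv_comp_add_right]
      exact hlip y z

theorem iteratedFDeriv_secondDiff {g : E → F} {j : ℕ} (hg : ContDiff ℝ j g) (x z : E) :
    iteratedFDeriv ℝ j (fun y => secondDiff g y z) x = secondDiff (iteratedFDeriv ℝ j g) x z := by
  have h1 : ContDiff ℝ j (fun y => g (y + z)) := by fun_prop
  have h2 : ContDiff ℝ j (fun y => g (y - z)) := by fun_prop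
  have h3 : ContDiff ℝ j (fun y => (2 : ℝ) • g y) := by fun_prop
  unfold secondDiff
  refine (iteratedFDeriv_sub_apply (h3.sub h1).contDiffAt h2.contDiffAt).trans ?_
  have h4 := iteratedFDeriv_sub_apply h3.contDiffAt h1.contDiffAt (x := x)
  change iteratedFDeriv ℝ j (fun y => (2 : ℝ) • g y - g (y + z)) x = _ at h4
  rw [h4, iteratedFDeriv_comp_add_right,
    iteratedFDeriv_comp_sub, iteratedFDeriv_const_smul_apply' hg.contDiffAt]

end Operator

section Operator

variable {n : ℕ} {σ : ℝ} {F : Type*} [NormedAddCommGroup F] [NormedSpace ℝ F]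

theorem measurable_norm_rpow (a : ℝ) : Measurable (fun z : Euc n => ‖z‖ ^ a) := by fun_prop

theorem integrable_fracOp (hn : 1 ≤ n) (hσ : σ ∈ Set.Ioo (0 : ℝ) 1) {g : Euc n → F}
    (hg : ContDiff ℝ 2 g) (hc : HasCompactSupport g) (x : Euc n) :
    Integrable (fun z : Euc n => ‖z‖ ^ (-((n : ℝ) + 2 * σ)) • secondDiff g x z) := by
  obtain ⟨B, hB0, hB⟩ := exists_norm_secondDiff_le hg hc
  refine ((integrable_min_one_sq_mul_rpow hn hσ).const_mul B).mono'
    ((measurable_norm_rpow _).aestronglyMeasurable.smul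
      (continuous_secondDiff_right hg.continuous x).aestronglyMeasurable) ?_
  refine Eventually.of_forall fun z => ?_
  rw [norm_smul, norm_of_nonneg (by positivity)]
  have : (0 : ℝ) ≤ ‖z‖ ^ (-((n : ℝ) + 2 * σ)) := by positivity
  nlinarith [mul_le_mul_of_nonneg_left (hB x z) this]

theorem exists_norm_fracOp_le (hn : 1 ≤ n) (hσ : σ ∈ Set.Ioo (0 : ℝ) 1) {g : Euc n → F}
    (hg : ContDiff ℝ 2 g) (hc : HasCompactSupport g) :
    ∃ C : ℝ, 0 ≤ C ∧ ∀ x, ‖fracOp n σ g x‖ ≤ C * (1 + ‖x‖) ^ (-((n : ℝ) + 2 * σ)) := by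
  obtain ⟨B, hB0, hB⟩ := exists_norm_secondDiff_le hg hc
  set p : ℝ := (n : ℝ) + 2 * σ with hp
  have hp0 : 0 < p := by have := hσ.1; positivity
  obtain ⟨R, hR0, hR⟩ : ∃ R : ℝ, 0 ≤ R ∧ ∀ x, R < ‖x‖ → g x = 0 := by
    obtain ⟨R, hR⟩ := hc.isCompact.isBounded.exists_norm_le
    refine ⟨max R 0, le_max_right _ _, fun x hx => ?_⟩
    by_contra h
    have := hR x (subset_tsupport _ h)
    linarith [le_max_left R 0]
  have hgi : Integrable (fun z => ‖g z‖) := (hg.continuous.integrable_of_hasCompactSupport hc).norm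
  obtain ⟨W, hW⟩ : ∃ W, W = ∫ z : Euc n, min 1 (‖z‖ ^ 2) * ‖z‖ ^ (-p) := ⟨_, rfl⟩
  have hW0 : 0 ≤ W := hW ▸ integral_nonneg fun z => by positivity
  obtain ⟨J, hJ⟩ : ∃ J, J = ∫ z : Euc n, ‖g z‖ := ⟨_, rfl⟩
  have hJ0 : 0 ≤ J := hJ ▸ integral_nonneg fun z => by positivity
  refine ⟨B * W * (2 * R + 2) ^ p + 2 * 2 ^ p * J, by positivity, fun x => ?_⟩
  have hx1 : 0 < 1 + ‖x‖ := by positivity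
  rcases le_or_gt ‖x‖ (2 * R + 1) with h | h
  · have h1 : ‖fracOp n σ g x‖ ≤ B * W := by
      rw [hW, ← integral_const_mul]
      refine norm_integral_le_of_norm_le ((integrable_min_one_sq_mul_rpow hn hσ).const_mul B) ?_
      refine Eventually.of_forall fun z => ?_
      rw [norm_smul, norm_of_nonneg (by positivity)]
      have : (0 : ℝ) ≤ ‖z‖ ^ (-p) := by positivity
      nlinarith [mul_le_mul_of_nonneg_left (hB x z) this]
    have h2 : 1 ≤ (2 * R + 2) ^ p * (1 + ‖x‖) ^ (-p) := by
      rw [rpow_neg hx1.le, ← div_eq_mul_inv, one_le_div (by positivity)]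
      exact rpow_le_rpow hx1.le (by linarith) hp0.le
    calc _ ≤ B * W * 1 := by rw [mul_one]; exact h1
      _ ≤ B * W * ((2 * R + 2) ^ p * (1 + ‖x‖) ^ (-p)) := by gcongr
      _ ≤ _ := by
        have : 0 ≤ 2 * 2 ^ p * J * (1 + ‖x‖) ^ (-p) := by positivity
        linarith
  · have hz : ∀ z : Euc n, ∀ w : Euc n, (w = x + z ∨ w = x - z) →
        ‖z‖ ^ (-p) * ‖g w‖ ≤ 2 ^ p * (1 + ‖x‖) ^ (-p) * ‖g w‖ := by
      intro z w hw
      by_cases hwR : R < ‖w‖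
      · rw [hR w hwR]; simp
      · have h3 : ‖x‖ ≤ ‖w‖ + ‖z‖ := by
          rcases hw with rfl | rfl
          · simpa using norm_sub_le (x + z) z
          · simpa using norm_add_le (x - z) z
        have h4 : (1 + ‖x‖) / 2 ≤ ‖z‖ := by linarith
        gcongr
        calc ‖z‖ ^ (-p) ≤ ((1 + ‖x‖) / 2) ^ (-p) :=
              rpow_le_rpow_of_nonpos (by positivity) h4 (by linarith)
          _ = 2 ^ p * (1 + ‖x‖) ^ (-p) := by
              rw [div_rpow hx1.le (by norm_num), rpow_neg (by norm_num : (0 : ℝ) ≤ 2)]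
              field_simp
    have h5 : ‖fracOp n σ g x‖ ≤ 2 ^ p * (1 + ‖x‖) ^ (-p) * (J + J) := by
      have e1 : J = ∫ z : Euc n, ‖g (x + z)‖ := by
        rw [hJ, integral_add_left_eq_self (fun z => ‖g z‖) x]
      have e2 : J = ∫ z : Euc n, ‖g (x - z)‖ := by
        rw [hJ, integral_sub_left_eq_self (fun z => ‖g z‖) volume x]
      have i1 : Integrable (fun z : Euc n => ‖g (x + z)‖) := hgi.comp_add_left x
      have i2 : Integrable (fun z : Euc n => ‖g (x - z)‖) := hgi.comp_sub_left x
      have e3 : J + J = ∫ z : Euc n, (‖g (x + z)‖ + ‖g (x - z)‖) := by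
        rw [integral_add i1 i2, ← e1, ← e2]
      rw [e3, ← integral_const_mul]
      refine norm_integral_le_of_norm_le ((i1.add i2).const_mul _) ?_
      refine Eventually.of_forall fun z => ?_
      rw [norm_smul, norm_of_nonneg (by positivity), secondDiff, hR x (by linarith)]
      have h6 : ‖(2 : ℝ) • (0 : F) - g (x + z) - g (x - z)‖ ≤ ‖g (x + z)‖ + ‖g (x - z)‖ := by
        rw [smul_zero, zero_sub, ← norm_neg (g (x + z))]
        exact norm_sub_le _ _
      have := hz z _ (Or.inl rfl)
      have := hz z _ (Or.inr rfl)
      have h7 : (0 : ℝ) ≤ ‖z‖ ^ (-p) := by positivity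
      nlinarith [mul_le_mul_of_nonneg_left h6 h7]
    calc _ ≤ _ := h5
      _ = 2 * 2 ^ p * J * (1 + ‖x‖) ^ (-p) := by ring
      _ ≤ _ := by
        have : 0 ≤ B * W * (2 * R + 2) ^ p * (1 + ‖x‖) ^ (-p) := by positivity
        linarith

theorem contDiff_fracOp [CompleteSpace F] (hn : 1 ≤ n) (hσ : σ ∈ Set.Ioo (0 : ℝ) 1) {g : Euc n → F}
    (hg : ∀ m : ℕ, ContDiff ℝ m g) (hc : HasCompactSupport g) (m : ℕ) :
    ContDiff ℝ m (fracOp n σ g) ∧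
      iteratedFDeriv ℝ m (fracOp n σ g) = fracOp n σ (iteratedFDeriv ℝ m g) := by
  have hd : ∀ j : ℕ, ContDiff ℝ 2 (iteratedFDeriv ℝ j g) := fun j =>
    (hg (2 + j)).iteratedFDeriv_right (m := 2) (by norm_num)
  have hcs : ∀ j : ℕ, HasCompactSupport (iteratedFDeriv ℝ j g) := fun j => hc.iteratedFDeriv j
  choose B hB0 hB using fun j => exists_norm_secondDiff_le (hd j) (hcs j)
  have hf : ∀ z : Euc n, ContDiff ℝ m
      (fun x => ‖z‖ ^ (-((n : ℝ) + 2 * σ)) • secondDiff g x z) := by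
    intro z
    unfold secondDiff
    have := hg m
    fun_prop
  have hD : ∀ (j : ℕ) (z x : Euc n),
      iteratedFDeriv ℝ j (fun x => ‖z‖ ^ (-((n : ℝ) + 2 * σ)) • secondDiff g x z) x =
      ‖z‖ ^ (-((n : ℝ) + 2 * σ)) • secondDiff (iteratedFDeriv ℝ j g) x z := by
    intro j z x
    have : ContDiff ℝ j (fun x => secondDiff g x z) := by
      unfold secondDiff
      have := hg j
      fun_prop
    rw [iteratedFDeriv_const_smul_apply' this.contDiffAt, iteratedFDeriv_secondDiff (hg j)]
  have h2 : ∀ j ≤ m, ∀ x ∈ (Set.univ : Set (Euc n)), AEStronglyMeasurable (fun z =>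
      iteratedFDeriv ℝ j (fun x => ‖z‖ ^ (-((n : ℝ) + 2 * σ)) • secondDiff g x z) x) := by
    intro j _ x _
    simp only [hD]
    exact (measurable_norm_rpow _).aestronglyMeasurable.smul
      (continuous_secondDiff_right (hd j).continuous x).aestronglyMeasurable
  have h3 : ∀ j ≤ m, Integrable (fun z : Euc n =>
      B j * (min 1 (‖z‖ ^ 2) * ‖z‖ ^ (-((n : ℝ) + 2 * σ)))) := fun j _ =>
    (integrable_min_one_sq_mul_rpow hn hσ).const_mul _
  have h4 : ∀ j ≤ m, ∀ᵐ z : Euc n, ∀ x ∈ (Set.univ : Set (Euc n)),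
      ‖iteratedFDeriv ℝ j (fun x => ‖z‖ ^ (-((n : ℝ) + 2 * σ)) • secondDiff g x z) x‖ ≤
      B j * (min 1 (‖z‖ ^ 2) * ‖z‖ ^ (-((n : ℝ) + 2 * σ))) := by
    intro j _
    refine Eventually.of_forall fun z x _ => ?_
    rw [hD, norm_smul, norm_of_nonneg (by positivity)]
    have : (0 : ℝ) ≤ ‖z‖ ^ (-((n : ℝ) + 2 * σ)) := by positivity
    nlinarith [mul_le_mul_of_nonneg_left (hB j x z) this]
  constructor
  · rw [← contDiffOn_univ]
    exact contDiffOn_integral isOpen_univ (fun z => (hf z).contDiffOn) h2 h3 h4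
  · ext1 x
    refine (iteratedFDeriv_integral isOpen_univ (fun z => (hf z).contDiffOn) h2 h3 h4 le_rfl
      (Set.mem_univ x)).trans ?_
    simp only [hD]
    rfl

end Operator

section Operator

variable {n : ℕ} {σ : ℝ}

theorem fracConst_pos (hσ : σ ∈ Set.Ioo (0 : ℝ) 1) : 0 < fracConst n σ := by
  obtain ⟨h0, h1⟩ := hσ
  have h : Real.Gamma (-σ) ≠ 0 := by
    refine Real.Gamma_ne_zero fun m hm => ?_
    rcases Nat.eq_zero_or_pos m with rfl | hm'
    · simp at hm; linarith
    · have : (1 : ℝ) ≤ m := by exact_mod_cast hm'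
      linarith
  have := Real.Gamma_pos_of_pos (s := (n : ℝ) / 2 + σ) (by positivity)
  unfold fracConst
  positivity

theorem fracLap_eq_fracOp (hn : 1 ≤ n) (hσ : σ ∈ Set.Ioo (0 : ℝ) 1) {φ : Euc n → ℝ}
    (hφ : ContDiff ℝ 2 φ) (hc : HasCompactSupport φ) (x : Euc n) :
    fracLap n σ φ x = fracConst n σ / 2 * fracOp n σ φ x := by
  set p : ℝ := (n : ℝ) + 2 * σ with hp
  obtain ⟨B, hB0, hB⟩ := exists_norm_le_of_hasCompactSupport hφ.continuous hc
  have hW := integrable_min_one_sq_mul_rpow hn hσ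
  have hcut : ∀ ε : ℝ, 0 < ε →
      ∫ y in {y : Euc n | ε < ‖x - y‖}, (φ x - φ y) / ‖x - y‖ ^ p =
      2⁻¹ * ∫ z, {z : Euc n | ε < ‖z‖}.indicator (fun z => ‖z‖ ^ (-p) • secondDiff φ x z) z := by
    intro ε hε
    set H : Euc n → ℝ := {y : Euc n | ε < ‖x - y‖}.indicator
      (fun y => (φ x - φ y) / ‖x - y‖ ^ p) with hH
    have hHm : MeasurableSet {y : Euc n | ε < ‖x - y‖} :=
      (isOpen_lt continuous_const (by fun_prop)).measurableSet
    have hHp : ∀ z, H (x + z) = {z : Euc n | ε < ‖z‖}.indicator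
        (fun z => ‖z‖ ^ (-p) * (φ x - φ (x + z))) z := by
      intro z
      simp only [hH, Set.indicator_apply, Set.mem_ofPred_eq, sub_add_cancel_left, norm_neg]
      rw [rpow_neg (norm_nonneg z), div_eq_inv_mul]
    have hint : Integrable (fun z => H (x + z)) := by
      simp only [hHp]
      refine (hW.const_mul (max 1 (ε ^ 2)⁻¹ * (2 * B))).mono' ?_ ?_
      · have := hφ.continuous
        exact (Measurable.indicator (by fun_prop)
          (isOpen_lt continuous_const (by fun_prop)).measurableSet).aestronglyMeasurable
      · refine Eventually.of_forall fun z => ?_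
        have hz0 : 0 ≤ ‖z‖ ^ (-p) := by positivity
        by_cases hz : ε < ‖z‖
        · rw [Set.indicator_of_mem (s := {z : Euc n | ε < ‖z‖}) hz, norm_mul, norm_of_nonneg hz0]
          have h1 : ‖φ x - φ (x + z)‖ ≤ 2 * B := (norm_sub_le _ _).trans (by linarith [hB x, hB (x + z)])
          have h2 : 1 ≤ max 1 (ε ^ 2)⁻¹ * min 1 (‖z‖ ^ 2) := by
            rcases le_total 1 (‖z‖ ^ 2) with h | h
            · rw [min_eq_left h, mul_one]; exact le_max_left _ _
            · rw [min_eq_right h]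
              calc 1 = (ε ^ 2)⁻¹ * ε ^ 2 := by field_simp
                _ ≤ _ := by gcongr; exact le_max_right _ _
          calc ‖z‖ ^ (-p) * ‖φ x - φ (x + z)‖ ≤ ‖z‖ ^ (-p) * (2 * B) := by gcongr
            _ = 1 * (2 * B * ‖z‖ ^ (-p)) := by ring
            _ ≤ (max 1 (ε ^ 2)⁻¹ * min 1 (‖z‖ ^ 2)) * (2 * B * ‖z‖ ^ (-p)) := by gcongr
            _ = _ := by ring
        · rw [Set.indicator_of_notMem (s := {z : Euc n | ε < ‖z‖}) hz, norm_zero]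
          positivity
    have hint' : Integrable (fun z => H (x - z)) := by
      simpa [sub_eq_add_neg] using hint.comp_neg
    have e1 := integral_add_left_eq_self H x (μ := volume)
    have e2 := integral_sub_left_eq_self H volume x
    have e3 : ∫ z, (H (x + z) + H (x - z)) = 2 * ∫ y, H y := by
      rw [integral_add hint hint', e1, e2]; ring
    rw [← integral_indicator hHm, ← hH, eq_inv_mul_iff_mul_eq₀ two_ne_zero, ← e3]
    congr 1
    ext z
    rw [hHp, sub_eq_add_neg x z, hHp]
    simp only [Set.indicator_apply, Set.mem_ofPred_eq, norm_neg, secondDiff, smul_eq_mul]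
    split_ifs
    · rw [sub_eq_add_neg x z]; ring
    · simp
  have hlim : Tendsto (fun ε : ℝ => ∫ y in {y : Euc n | ε < ‖x - y‖}, (φ x - φ y) / ‖x - y‖ ^ p)
      (nhdsWithin 0 (Set.Ioi 0)) (nhds (2⁻¹ * fracOp n σ φ x)) := by
    have h1 : Tendsto (fun ε : ℝ =>
        ∫ z, {z : Euc n | ε < ‖z‖}.indicator (fun z => ‖z‖ ^ (-p) • secondDiff φ x z) z)
        (nhdsWithin 0 (Set.Ioi 0)) (nhds (fracOp n σ φ x)) := by
      have hi := integrable_fracOp hn hσ hφ hc x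
      refine tendsto_integral_filter_of_dominated_convergence _ ?_ ?_ hi.norm ?_
      · exact Eventually.of_forall fun ε => hi.aestronglyMeasurable.indicator
          (isOpen_lt continuous_const (by fun_prop)).measurableSet
      · exact Eventually.of_forall fun ε => Eventually.of_forall fun z =>
          norm_indicator_le_norm_self _ _
      · refine Eventually.of_forall fun z => ?_
        rcases eq_or_ne z 0 with rfl | hz
        · refine tendsto_const_nhds.congr fun ε => ?_
          have : secondDiff φ x 0 = 0 := by simp [secondDiff]; ring
          simp only [Set.indicator_apply, this, smul_zero, ite_self]
        · refine tendsto_const_nhds.congr' ?_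
          have : ∀ᶠ ε : ℝ in nhdsWithin 0 (Set.Ioi 0), ε < ‖z‖ :=
            nhdsWithin_le_nhds (gt_mem_nhds (norm_pos_iff.2 hz))
          filter_upwards [this] with ε hε
          rw [Set.indicator_of_mem (s := {z : Euc n | ε < ‖z‖}) hε]
    refine (h1.const_mul 2⁻¹).congr' ?_
    filter_upwards [self_mem_nhdsWithin] with ε hε using (hcut ε hε).symm
  rw [fracLap, hlim.limUnder_eq]
  ring

theorem fracOp_comp_smul_sub {F : Type*} [NormedAddCommGroup F] [NormedSpace ℝ F]
    (g : Euc n → F) {r : ℝ} (hr : 0 < r) (x y : Euc n) :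
    fracOp n σ (fun y => g (r • (x - y))) y = r ^ (2 * σ) • fracOp n σ g (r • (x - y)) := by
  have h := Measure.integral_comp_smul_of_nonneg (volume : Measure (Euc n))
    (fun z => ‖z‖ ^ (-((n : ℝ) + 2 * σ)) • secondDiff g (r • (x - y)) z) r
    (hR := hr.le)
  unfold fracOp
  have e : (r : ℝ) ^ (2 * σ) = r ^ ((n : ℝ) + 2 * σ) * (r ^ Module.finrank ℝ (Euc n))⁻¹ := by
    rw [rpow_add hr, rpow_natCast, finrank_euclideanSpace, Fintype.card_fin]
    field_simp
  rw [e, mul_smul, ← h, ← integral_smul]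
  congr 1
  ext z
  have e1 : secondDiff (fun y => g (r • (x - y))) y z = secondDiff g (r • (x - y)) (r • z) := by
    simp only [secondDiff]
    rw [sub_right_comm]
    congr 3
    · module
    · module
  rw [e1, smul_smul, norm_smul, norm_of_nonneg hr.le, mul_rpow hr.le (norm_nonneg z),
    ← mul_assoc, ← rpow_add hr]
  simp

end Operator

section Radial

variable {n : ℕ} {σ : ℝ}

theorem fracOp_eq_of_norm_eq {g : Euc n → ℝ} (hg : ∀ x y, ‖x‖ = ‖y‖ → g x = g y) {x y : Euc n}
    (hxy : ‖x‖ = ‖y‖) : fracOp n σ g x = fracOp n σ g y := by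
  let T : Euc n ≃ₗᵢ[ℝ] Euc n := (Submodule.span ℝ {x - y})ᗮ.reflection
  have hT : T x = y := Submodule.reflection_sub hxy
  have h := (T.measurePreserving).integral_comp T.toHomeomorph.measurableEmbedding
    (fun z => ‖z‖ ^ (-((n : ℝ) + 2 * σ)) • secondDiff g y z)
  unfold fracOp
  rw [← h]
  congr 1
  ext z
  have hs : secondDiff g y (T z) = secondDiff g x z := by
    rw [← hT, secondDiff, secondDiff, ← map_add, ← map_sub, hg (T x) x (T.norm_map x),
      hg (T (x + z)) (x + z) (T.norm_map _), hg (T (x - z)) (x - z) (T.norm_map _)]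
  rw [hs, T.norm_map]

theorem integrable_prod_secondDiff (hn : 1 ≤ n) (hσ : σ ∈ Set.Ioo (0 : ℝ) 1) {g : Euc n → ℝ}
    (hg : ContDiff ℝ 2 g) (hc : HasCompactSupport g) :
    Integrable (fun q : Euc n × Euc n => ‖q.2‖ ^ (-((n : ℝ) + 2 * σ)) • secondDiff g q.1 q.2)
      (volume.prod volume) := by
  have hcont := hg.continuous
  have hgi : Integrable g := hcont.integrable_of_hasCompactSupport hc
  have hmeas : AEStronglyMeasurable
      (fun q : Euc n × Euc n => ‖q.2‖ ^ (-((n : ℝ) + 2 * σ)) • secondDiff g q.1 q.2)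
      (volume.prod volume) := by
    unfold secondDiff
    exact (by fun_prop : Measurable _).aestronglyMeasurable
  have hsd : ∀ z, Integrable (fun x => secondDiff g x z) := fun z =>
    ((hgi.smul (2 : ℝ)).sub (hgi.comp_add_right z)).sub (hgi.comp_sub_right z)
  obtain ⟨B, hB0, hB⟩ := exists_norm_secondDiff_le hg hc
  obtain ⟨R, hR⟩ := hc.isCompact.isBounded.exists_norm_le
  obtain ⟨V, hV⟩ : ∃ V, V = volume.real (Metric.closedBall (0 : Euc n) (R + 1)) := ⟨_, rfl⟩
  obtain ⟨J, hJ⟩ : ∃ J, J = ∫ x, ‖g x‖ := ⟨_, rfl⟩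
  have hV0 : 0 ≤ V := hV ▸ measureReal_nonneg
  have hJ0 : 0 ≤ J := hJ ▸ integral_nonneg fun x => norm_nonneg _
  have key : ∀ z, ∫ x, ‖secondDiff g x z‖ ≤ (B * V + 4 * J) * min 1 (‖z‖ ^ 2) := by
    intro z
    rcases le_or_gt ‖z‖ 1 with h | h
    · have h2 : ‖z‖ ^ 2 ≤ 1 := pow_le_one₀ (norm_nonneg _) h
      have hb : ∀ x, ‖secondDiff g x z‖ ≤
          (Metric.closedBall (0 : Euc n) (R + 1)).indicator (fun _ => B * ‖z‖ ^ 2) x := by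
        intro x
        by_cases hx : x ∈ Metric.closedBall (0 : Euc n) (R + 1)
        · rw [Set.indicator_of_mem hx]
          simpa [min_eq_right h2] using hB x z
        · rw [Set.indicator_of_notMem hx]
          rw [mem_closedBall_zero_iff, not_le] at hx
          have hz : ∀ w, R < ‖w‖ → g w = 0 := fun w hw => by
            by_contra h'
            linarith [hR w (subset_tsupport _ h')]
          have h3 : ‖x‖ ≤ ‖x + z‖ + ‖z‖ := by simpa using norm_sub_le (x + z) z
          have h4 : ‖x‖ ≤ ‖x - z‖ + ‖z‖ := by simpa using norm_add_le (x - z) z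
          rw [secondDiff, hz x (by linarith), hz (x + z) (by linarith), hz (x - z) (by linarith)]
          simp
      calc ∫ x, ‖secondDiff g x z‖ ≤ ∫ x,
            (Metric.closedBall (0 : Euc n) (R + 1)).indicator (fun _ => B * ‖z‖ ^ 2) x := by
            refine integral_mono (hsd z).norm ?_ hb
            exact (integrable_indicator_iff measurableSet_closedBall).2
              (integrableOn_const measure_closedBall_lt_top.ne)
        _ = B * V * ‖z‖ ^ 2 := by
            rw [integral_indicator measurableSet_closedBall, setIntegral_const, hV, smul_eq_mul]
            ring
        _ ≤ _ := by
            rw [min_eq_right h2]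
            have : 0 ≤ 4 * J * ‖z‖ ^ 2 := by positivity
            linarith
    · have h2 : 1 ≤ ‖z‖ ^ 2 := one_le_pow₀ h.le
      have e1 : ∫ x, ‖g (x + z)‖ = J := by
        rw [hJ, integral_add_right_eq_self (fun x => ‖g x‖) z]
      have e2 : ∫ x, ‖g (x - z)‖ = J := by
        rw [hJ, integral_sub_right_eq_self (fun x => ‖g x‖) z]
      have i1 : Integrable (fun x => ‖g (x + z)‖) := (hgi.comp_add_right z).norm
      have i2 : Integrable (fun x => ‖g (x - z)‖) := (hgi.comp_sub_right z).norm
      have i3 : Integrable (fun x => 2 * ‖g x‖) := hgi.norm.const_mul 2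
      have i4 : Integrable (fun x => 2 * ‖g x‖ + ‖g (x + z)‖) := i3.add i1
      calc ∫ x, ‖secondDiff g x z‖ ≤ ∫ x, (2 * ‖g x‖ + ‖g (x + z)‖ + ‖g (x - z)‖) := by
            refine integral_mono (hsd z).norm (i4.add i2) fun x => ?_
            refine (norm_sub_le _ _).trans ?_
            gcongr
            refine (norm_sub_le _ _).trans ?_
            gcongr
            rw [norm_smul]
            norm_num
        _ = 4 * J := by
            rw [integral_add i4 i2, integral_add i3 i1, e1, e2, integral_const_mul, ← hJ]
            ring
        _ ≤ _ := by
            rw [min_eq_left h2]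
            have : 0 ≤ B * V := by positivity
            linarith
  rw [integrable_prod_iff' hmeas]
  refine ⟨Eventually.of_forall fun z => (hsd z).const_mul (‖z‖ ^ (-((n : ℝ) + 2 * σ))), ?_⟩
  refine ((integrable_min_one_sq_mul_rpow hn hσ).const_mul (B * V + 4 * J)).mono'
    hmeas.norm.prod_swap.integral_prod_right' (Eventually.of_forall fun z => ?_)
  have hz : (0 : ℝ) ≤ ‖z‖ ^ (-((n : ℝ) + 2 * σ)) := by positivity
  simp only [norm_smul, norm_of_nonneg hz]
  rw [integral_const_mul, norm_of_nonneg (mul_nonneg hz (integral_nonneg fun x => norm_nonneg _))]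
  nlinarith [mul_le_mul_of_nonneg_left (key z) hz]

theorem integrable_fracOp_self (hn : 1 ≤ n) (hσ : σ ∈ Set.Ioo (0 : ℝ) 1) {g : Euc n → ℝ}
    (hg : ContDiff ℝ 2 g) (hc : HasCompactSupport g) : Integrable (fracOp n σ g) :=
  (integrable_prod_secondDiff hn hσ hg hc).integral_prod_left

theorem setIntegral_fracOp (hn : 1 ≤ n) (hσ : σ ∈ Set.Ioo (0 : ℝ) 1) {g : Euc n → ℝ}
    (hg : ContDiff ℝ 2 g) (hc : HasCompactSupport g) (s : Set (Euc n)) :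
    ∫ x in s, fracOp n σ g x =
      ∫ z, ‖z‖ ^ (-((n : ℝ) + 2 * σ)) * ∫ x in s, secondDiff g x z := by
  have h := (integrable_prod_secondDiff hn hσ hg hc).restrict (s := s ×ˢ Set.univ)
  rw [← Measure.prod_restrict, Measure.restrict_univ] at h
  simp only [fracOp]
  rw [integral_integral_swap h]
  simp only [smul_eq_mul, integral_const_mul]

theorem integral_secondDiff {g : Euc n → ℝ} (hgi : Integrable g) (z : Euc n) :
    ∫ x, secondDiff g x z = 0 := by
  have i1 := hgi.comp_add_right z
  have i2 := hgi.comp_sub_right z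
  have i3 : Integrable (fun x => (2 : ℝ) • g x) := hgi.smul (2 : ℝ)
  have i4 : Integrable (fun x => (2 : ℝ) • g x - g (x + z)) := i3.sub i1
  unfold secondDiff
  rw [integral_sub i4 i2, integral_sub i3 i1, integral_add_right_eq_self g z,
    integral_sub_right_eq_self g z, integral_smul, smul_eq_mul]
  ring

theorem integral_fracOp (hn : 1 ≤ n) (hσ : σ ∈ Set.Ioo (0 : ℝ) 1) {g : Euc n → ℝ}
    (hg : ContDiff ℝ 2 g) (hc : HasCompactSupport g) : ∫ x, fracOp n σ g x = 0 := by
  rw [← setIntegral_univ, setIntegral_fracOp hn hσ hg hc]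
  simp [integral_secondDiff (hg.continuous.integrable_of_hasCompactSupport hc)]

/-- A radially decreasing function has its largest integral over a ball when the ball is
centred. -/
theorem setIntegral_ball_comp_add_le (hn : 1 ≤ n) {g : Euc n → ℝ} (hgi : Integrable g)
    (hg : ∀ x y, ‖x‖ ≤ ‖y‖ → g y ≤ g x) {r : ℝ} (hr : 0 ≤ r) (z : Euc n) :
    ∫ x in Metric.ball 0 r, g (x + z) ≤ ∫ x in Metric.ball 0 r, g x := by
  have : NeZero n := ⟨by omega⟩
  have : Nontrivial (Euc n) := inferInstance
  obtain ⟨e, he⟩ := exists_norm_eq (Euc n) hr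
  set s : Set (Euc n) := Metric.ball 0 r
  have hs : MeasurableSet s := measurableSet_ball
  have hconst : IntegrableOn (fun _ : Euc n => g e) s := integrableOn_const measure_ball_lt_top.ne
  have i1 : IntegrableOn (fun x => g x - g e) s := hgi.integrableOn.sub hconst
  have i2 : IntegrableOn (fun x => g (x + z) - g e) s :=
    (hgi.comp_add_right z).integrableOn.sub hconst
  set h : Euc n → ℝ := s.indicator (fun x => g x - g e) with hh
  have hhi : Integrable h := (integrable_indicator_iff hs).2 i1
  have hh0 : ∀ x, 0 ≤ h x := fun x => Set.indicator_nonneg (fun x hx => by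
    have : ‖x‖ < r := mem_ball_zero_iff.1 hx
    linarith [hg x e (by linarith)]) x
  have hle : ∀ x, g x - g e ≤ h x := fun x => by
    by_cases hx : x ∈ s
    · rw [hh, Set.indicator_of_mem hx]
    · rw [hh, Set.indicator_of_notMem hx]
      have : r ≤ ‖x‖ := by simpa [s] using hx
      linarith [hg e x (by linarith)]
  have key : ∫ x in s, (g (x + z) - g e) ≤ ∫ x in s, (g x - g e) := by
    calc ∫ x in s, (g (x + z) - g e) ≤ ∫ x in s, h (x + z) :=
          integral_mono i2 (hhi.comp_add_right z).integrableOn fun x => hle _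
      _ ≤ ∫ x, h (x + z) :=
          setIntegral_le_integral (hhi.comp_add_right z) (Eventually.of_forall fun x => hh0 _)
      _ = ∫ x, h x := integral_add_right_eq_self h z
      _ = _ := by rw [hh, integral_indicator hs]
  rw [integral_sub (hgi.comp_add_right z).integrableOn hconst,
    integral_sub hgi.integrableOn hconst] at key
  linarith

theorem setIntegral_ball_fracOp_nonneg (hn : 1 ≤ n) (hσ : σ ∈ Set.Ioo (0 : ℝ) 1) {g : Euc n → ℝ}
    (hg : ContDiff ℝ 2 g) (hc : HasCompactSupport g) (hmono : ∀ x y, ‖x‖ ≤ ‖y‖ → g y ≤ g x)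
    {r : ℝ} (hr : 0 ≤ r) : 0 ≤ ∫ x in Metric.ball 0 r, fracOp n σ g x := by
  have hgi : Integrable g := hg.continuous.integrable_of_hasCompactSupport hc
  rw [setIntegral_fracOp hn hσ hg hc]
  refine integral_nonneg fun z => mul_nonneg (by positivity) ?_
  have i3 : Integrable (fun x => (2 : ℝ) • g x) := hgi.smul (2 : ℝ)
  have i1 := hgi.comp_add_right z
  have i2 := hgi.comp_sub_right z
  have h1 := setIntegral_ball_comp_add_le hn hgi hmono hr z
  have h2 := setIntegral_ball_comp_add_le hn hgi hmono hr (-z)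
  simp only [← sub_eq_add_neg] at h2
  have i4 : Integrable (fun x => (2 : ℝ) • g x - g (x + z)) := i3.sub i1
  unfold secondDiff
  rw [integral_sub i4.integrableOn i2.integrableOn,
    integral_sub i3.integrableOn i1.integrableOn, integral_smul, smul_eq_mul]
  linarith

end Radial

section Dilation

variable {n : ℕ} {F : Type*} [NormedAddCommGroup F] [NormedSpace ℝ F] [CompleteSpace F]

/-- Weighted averages of the dilations of a smooth function with bounded derivatives. -/
theorem contDiff_dilation {w : ℝ → ℝ} {I : Set ℝ} (hI : MeasurableSet I)
    (hI2 : I ⊆ Set.Icc 0 2) (hw : IntegrableOn w I) {h : Euc n → F}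
    (hh : ∀ m : ℕ, ContDiff ℝ m h) {C : ℕ → ℝ} (hC : ∀ j x, ‖iteratedFDeriv ℝ j h x‖ ≤ C j) (m : ℕ) :
    ContDiff ℝ m (fun x => ∫ s in I, w s • h (s • x)) ∧
      ∀ x, iteratedFDeriv ℝ m (fun x => ∫ s in I, w s • h (s • x)) x =
        ∫ s in I, w s • s ^ m • iteratedFDeriv ℝ m h (s • x) := by
  have hf : ∀ s : ℝ, ContDiff ℝ m (fun x => w s • h (s • x)) := fun s => by
    have := hh m
    fun_prop
  have hD : ∀ (j : ℕ) (s : ℝ) (x : Euc n), iteratedFDeriv ℝ j (fun x => w s • h (s • x)) x =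
      w s • s ^ j • iteratedFDeriv ℝ j h (s • x) := by
    intro j s x
    have h1 : ContDiff ℝ j (fun x => h (s • x)) := by
      have := hh j
      fun_prop
    rw [iteratedFDeriv_const_smul_apply' h1.contDiffAt, iteratedFDeriv_comp_const_smul s (hh j)]
  have h2 : ∀ j ≤ m, ∀ x ∈ (Set.univ : Set (Euc n)), AEStronglyMeasurable
      (fun s => iteratedFDeriv ℝ j (fun x => w s • h (s • x)) x) (volume.restrict I) := by
    intro j _ x _
    simp only [hD]
    have : Continuous (iteratedFDeriv ℝ j h) := (hh j).continuous_iteratedFDeriv le_rfl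
    exact hw.aestronglyMeasurable.smul
      (by fun_prop : Continuous fun s : ℝ => s ^ j • iteratedFDeriv ℝ j h (s • x)).aestronglyMeasurable
  have h3 : ∀ j ≤ m, Integrable (fun s => ‖w s‖ * (2 ^ j * C j)) (volume.restrict I) :=
    fun j _ => hw.norm.mul_const _
  have h4 : ∀ j ≤ m, ∀ᵐ s ∂(volume.restrict I), ∀ x ∈ (Set.univ : Set (Euc n)),
      ‖iteratedFDeriv ℝ j (fun x => w s • h (s • x)) x‖ ≤ ‖w s‖ * (2 ^ j * C j) := by
    intro j _
    filter_upwards [ae_restrict_mem hI] with s hs x _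
    obtain ⟨hs0, hs2⟩ := hI2 hs
    rw [hD, norm_smul, norm_smul, norm_pow, norm_of_nonneg hs0]
    gcongr
    exact hC j _
  constructor
  · rw [← contDiffOn_univ]
    exact contDiffOn_integral isOpen_univ (fun z => (hf z).contDiffOn) h2 h3 h4
  · intro x
    refine (iteratedFDeriv_integral isOpen_univ (fun z => (hf z).contDiffOn) h2 h3 h4 le_rfl
      (Set.mem_univ x)).trans ?_
    simp only [hD]

end Dilation

section Bump

variable {n : ℕ} {σ : ℝ}

/-- A smooth radially decreasing bump function supported in the ball of radius `1/2`. -/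
noncomputable def radialBump (n : ℕ) (x : Euc n) : ℝ := expNegInvGlue (1 / 4 - ‖x‖ ^ 2)

theorem contDiff_radialBump (m : ℕ) : ContDiff ℝ m (radialBump n) :=
  (expNegInvGlue.contDiff (n := m)).comp (contDiff_const.sub (contDiff_norm_sq ℝ))

theorem radialBump_mono {x y : Euc n} (h : ‖x‖ ≤ ‖y‖) : radialBump n y ≤ radialBump n x :=
  expNegInvGlue.monotone (by gcongr)

theorem radialBump_eq_of_norm_eq {x y : Euc n} (h : ‖x‖ = ‖y‖) :
    radialBump n x = radialBump n y := by simp [radialBump, h]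

theorem radialBump_eq_zero {x : Euc n} (h : 1 / 2 ≤ ‖x‖) : radialBump n x = 0 :=
  expNegInvGlue.zero_of_nonpos (by nlinarith)

theorem radialBump_zero_pos : 0 < radialBump n 0 :=
  expNegInvGlue.pos_of_pos (by norm_num)

theorem hasCompactSupport_radialBump : HasCompactSupport (radialBump n) :=
  HasCompactSupport.intro (isCompact_closedBall 0 (1 / 2)) fun x hx =>
    radialBump_eq_zero (by simpa using (lt_of_not_ge (by simpa using hx) : (2⁻¹ : ℝ) < ‖x‖).le)

/-- The fractional operator applied to the radial bump. -/
noncomputable def fracBump (n : ℕ) (σ : ℝ) : Euc n → ℝ := fracOp n σ (radialBump n)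

theorem contDiff_fracBump (hn : 1 ≤ n) (hσ : σ ∈ Set.Ioo (0 : ℝ) 1) (m : ℕ) :
    ContDiff ℝ m (fracBump n σ) :=
  (contDiff_fracOp hn hσ contDiff_radialBump hasCompactSupport_radialBump m).1

theorem exists_norm_iteratedFDeriv_fracBump_le (hn : 1 ≤ n) (hσ : σ ∈ Set.Ioo (0 : ℝ) 1) (m : ℕ) :
    ∃ C : ℝ, 0 ≤ C ∧ ∀ x, ‖iteratedFDeriv ℝ m (fracBump n σ) x‖ ≤
      C * (1 + ‖x‖) ^ (-((n : ℝ) + 2 * σ)) := by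
  rw [fracBump, (contDiff_fracOp hn hσ contDiff_radialBump hasCompactSupport_radialBump m).2]
  exact exists_norm_fracOp_le hn hσ
    ((contDiff_radialBump (2 + m)).iteratedFDeriv_right (m := 2) (by norm_num))
    (hasCompactSupport_radialBump.iteratedFDeriv m)

theorem fracBump_eq_of_norm_eq {x y : Euc n} (h : ‖x‖ = ‖y‖) : fracBump n σ x = fracBump n σ y :=
  fracOp_eq_of_norm_eq (fun _ _ => radialBump_eq_of_norm_eq) h

theorem fracBump_zero_pos (hn : 1 ≤ n) (hσ : σ ∈ Set.Ioo (0 : ℝ) 1) : 0 < fracBump n σ 0 := by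
  have : NeZero n := ⟨by omega⟩
  have : Nontrivial (Euc n) := inferInstance
  have hi := integrable_fracOp hn hσ (contDiff_radialBump 2) hasCompactSupport_radialBump (0 : Euc n)
  have hsd : ∀ z : Euc n, secondDiff (radialBump n) 0 z = 2 * (radialBump n 0 - radialBump n z) := by
    intro z
    have : radialBump n (-z) = radialBump n z := radialBump_eq_of_norm_eq (norm_neg z)
    simp [secondDiff, this]
    ring
  unfold fracBump fracOp
  rw [integral_pos_iff_support_of_nonneg _ hi]
  · refine lt_of_lt_of_le ?_ (measure_mono (s := {z : Euc n | 1 / 2 < ‖z‖}) fun z hz => ?_)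
    · refine IsOpen.measure_pos _ (isOpen_lt continuous_const continuous_norm) ?_
      obtain ⟨e, he⟩ := exists_norm_eq (Euc n) zero_le_one
      exact ⟨e, by simp [he]; norm_num⟩
    · have hz' : 1 / 2 < ‖z‖ := hz
      have h0 : 0 < ‖z‖ := by linarith
      have := radialBump_zero_pos (n := n)
      rw [Function.mem_support, hsd, radialBump_eq_zero hz'.le]
      positivity
  · intro z
    have : radialBump n z ≤ radialBump n 0 := radialBump_mono (by simp)
    simp only [Pi.zero_apply, hsd, smul_eq_mul]
    have : 0 ≤ radialBump n 0 - radialBump n z := by linarith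
    positivity

/-- The spherical primitive of `fracBump`. -/
noncomputable def avgKernel (n : ℕ) (σ : ℝ) (x : Euc n) : ℝ :=
  ∫ s in Set.Ioc (0 : ℝ) 1, s ^ (n - 1) • fracBump n σ (s • x)

theorem contDiff_avgKernel (hn : 1 ≤ n) (hσ : σ ∈ Set.Ioo (0 : ℝ) 1) (m : ℕ) :
    ContDiff ℝ m (avgKernel n σ) ∧ ∀ x, iteratedFDeriv ℝ m (avgKernel n σ) x =
      ∫ s in Set.Ioc (0 : ℝ) 1, s ^ (n - 1) • s ^ m • iteratedFDeriv ℝ m (fracBump n σ) (s • x) := by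
  choose C hC0 hC using exists_norm_iteratedFDeriv_fracBump_le (n := n) hn hσ
  refine contDiff_dilation (w := fun s => s ^ (n - 1)) measurableSet_Ioc
    (fun s hs => ⟨hs.1.le, by linarith [hs.2]⟩) ?_ (contDiff_fracBump hn hσ) (C := C) ?_ m
  · exact (continuous_pow _).integrableOn_Ioc
  · intro j x
    refine (hC j x).trans (mul_le_of_le_one_right (hC0 j) ?_)
    exact rpow_le_one_of_one_le_of_nonpos (by simp) (by have := hσ.1; have := n.cast_nonneg (α := ℝ); linarith)

theorem exists_norm_iteratedFDeriv_avgKernel_le_of_two_le (hn : 1 ≤ n)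
    (hσ : σ ∈ Set.Ioo (0 : ℝ) 1) {m : ℕ} (hm : 2 ≤ m) :
    ∃ C : ℝ, 0 ≤ C ∧ ∀ x, ‖iteratedFDeriv ℝ m (avgKernel n σ) x‖ ≤
      C * (1 + ‖x‖) ^ (-((n : ℝ) + 2 * σ)) := by
  obtain ⟨h0, h1⟩ := hσ
  obtain ⟨C, hC0, hC⟩ := exists_norm_iteratedFDeriv_fracBump_le (n := n) hn ⟨h0, h1⟩ m
  set p : ℝ := (n : ℝ) + 2 * σ with hp
  have hp0 : 0 < p := by positivity
  have hm' : (2 : ℝ) ≤ m := by exact_mod_cast hm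
  have hint : IntegrableOn (fun s : ℝ => s ^ (m - 1 - 2 * σ)) (Set.Ioc 0 1) := by
    have := intervalIntegral.intervalIntegrable_rpow' (a := 0) (b := 1)
      (r := m - 1 - 2 * σ) (by linarith)
    rwa [intervalIntegrable_iff_integrableOn_Ioc_of_le zero_le_one] at this
  obtain ⟨J, hJ⟩ : ∃ J, J = ∫ s in Set.Ioc (0 : ℝ) 1, s ^ (m - 1 - 2 * σ) := ⟨_, rfl⟩
  have hJ0 : 0 ≤ J := hJ ▸ setIntegral_nonneg measurableSet_Ioc fun s hs =>
    rpow_nonneg hs.1.le _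
  refine ⟨C * J, by positivity, fun x => ?_⟩
  rw [(contDiff_avgKernel hn ⟨h0, h1⟩ m).2]
  have hx : 0 ≤ (1 + ‖x‖) ^ (-p) := by positivity
  calc _ ≤ ∫ s in Set.Ioc (0 : ℝ) 1, C * (1 + ‖x‖) ^ (-p) * s ^ (m - 1 - 2 * σ) := by
        refine norm_integral_le_of_norm_le (hint.const_mul _) ?_
        filter_upwards [ae_restrict_mem measurableSet_Ioc] with s hs
        have hs0 : 0 < s := hs.1
        have h2 : (1 + ‖s • x‖) ^ (-p) ≤ s ^ (-p) * (1 + ‖x‖) ^ (-p) := by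
          rw [← mul_rpow hs0.le (by positivity)]
          refine rpow_le_rpow_of_nonpos (by positivity) ?_ (by linarith)
          rw [norm_smul, norm_of_nonneg hs0.le]
          linarith [hs.2]
        rw [norm_smul, norm_smul, norm_pow, norm_pow, norm_of_nonneg hs0.le]
        calc s ^ (n - 1) * (s ^ m * ‖iteratedFDeriv ℝ m (fracBump n σ) (s • x)‖)
            ≤ s ^ (n - 1) * (s ^ m * (C * (s ^ (-p) * (1 + ‖x‖) ^ (-p)))) := by
              gcongr
              exact (hC _).trans (by gcongr)
          _ = C * (1 + ‖x‖) ^ (-p) * (s ^ (n - 1) * s ^ m * s ^ (-p)) := by ring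
          _ = _ := by
              congr 1
              rw [← rpow_natCast s (n - 1), ← rpow_natCast s m, ← rpow_add hs0, ← rpow_add hs0,
                Nat.cast_sub hn]
              congr 1
              rw [hp]
              push_cast
              ring
    _ = _ := by rw [integral_const_mul, ← hJ]; ring

end Bump

section Kernel

variable {n : ℕ} {σ : ℝ}

theorem volume_real_ball_pos (x : Euc n) {r : ℝ} (hr : 0 < r) :
    0 < volume.real (Metric.ball x r) :=
  ENNReal.toReal_pos (Metric.measure_ball_pos _ _ hr).ne' measure_ball_lt_top.ne

theorem norm_pow_mul_avgKernel {e : Euc n} (he : ‖e‖ = 1) (hn : 1 ≤ n) (x : Euc n) :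
    ‖x‖ ^ n * avgKernel n σ x = ∫ t in (0 : ℝ)..‖x‖, t ^ (n - 1) • fracBump n σ (t • e) := by
  have h := intervalIntegral.smul_integral_comp_mul_right (a := 0) (b := 1)
    (fun t : ℝ => t ^ (n - 1) • fracBump n σ (t • e)) ‖x‖
  rw [zero_mul, one_mul] at h
  rw [← h, avgKernel, ← intervalIntegral.integral_of_le zero_le_one, smul_eq_mul,
    ← intervalIntegral.integral_const_mul, ← intervalIntegral.integral_const_mul]
  congr 1
  ext s
  have h1 : fracBump n σ ((s * ‖x‖) • e) = fracBump n σ (s • x) :=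
    fracBump_eq_of_norm_eq (by simp [norm_smul, he])
  obtain ⟨k, rfl⟩ : ∃ k, n = k + 1 := ⟨n - 1, by omega⟩
  simp only [h1, smul_eq_mul, Nat.add_sub_cancel]
  ring

theorem setIntegral_ball_fracBump {e : Euc n} (he : ‖e‖ = 1) (hn : 1 ≤ n) {r : ℝ} (hr : 0 ≤ r) :
    ∫ x in Metric.ball 0 r, fracBump n σ x = n * volume.real (Metric.ball (0 : Euc n) 1) *
      ∫ t in (0 : ℝ)..r, t ^ (n - 1) • fracBump n σ (t • e) := by
  have : NeZero n := ⟨by omega⟩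
  have : Nontrivial (Euc n) := inferInstance
  have h := integral_fun_norm_addHaar (volume : Measure (Euc n))
    ((Set.Iio r).indicator fun t : ℝ => fracBump n σ (t • e))
  rw [← integral_indicator measurableSet_ball, intervalIntegral.integral_of_le hr,
    integral_Ioc_eq_integral_Ioo]
  simp only [finrank_euclideanSpace, Fintype.card_fin, nsmul_eq_mul, smul_eq_mul] at h
  rw [mul_assoc]
  convert h using 2
  · ext x
    by_cases hx : ‖x‖ < r
    · rw [Set.indicator_of_mem (by simpa using hx), Set.indicator_of_mem (by simpa using hx)]
      exact fracBump_eq_of_norm_eq (by simp [norm_smul, he])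
    · rw [Set.indicator_of_notMem (by simpa using hx), Set.indicator_of_notMem (by simpa using hx)]
  · congr 1
    rw [← integral_indicator measurableSet_Ioo, ← integral_indicator measurableSet_Ioi]
    congr 1
    ext t
    simp only [Set.indicator_apply, Set.mem_Ioo, Set.mem_Ioi, Set.mem_Iio, smul_eq_mul]
    split_ifs <;> simp_all

theorem integral_Ioi_fracBump {e : Euc n} (he : ‖e‖ = 1) (hn : 1 ≤ n)
    (hσ : σ ∈ Set.Ioo (0 : ℝ) 1) :
    IntegrableOn (fun t : ℝ => t ^ (n - 1) • fracBump n σ (t • e)) (Set.Ioi 0) ∧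
      ∫ t in Set.Ioi (0 : ℝ), t ^ (n - 1) • fracBump n σ (t • e) = 0 := by
  have : NeZero n := ⟨by omega⟩
  have : Nontrivial (Euc n) := inferInstance
  have e1 : (fun x : Euc n => fracBump n σ (‖x‖ • e)) = fracBump n σ := by
    ext x
    exact fracBump_eq_of_norm_eq (by simp [norm_smul, he])
  have h := integral_fun_norm_addHaar (volume : Measure (Euc n)) (fun t : ℝ => fracBump n σ (t • e))
  have h' := integrable_fun_norm_addHaar (volume : Measure (Euc n))
    (f := fun t : ℝ => fracBump n σ (t • e))
  rw [e1] at h'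
  rw [e1, fracBump, integral_fracOp hn hσ (contDiff_radialBump 2) hasCompactSupport_radialBump] at h
  simp only [finrank_euclideanSpace, Fintype.card_fin, nsmul_eq_mul] at h h'
  refine ⟨h'.1 (integrable_fracOp_self hn hσ (contDiff_radialBump 2) hasCompactSupport_radialBump), ?_⟩
  have hV : 0 < volume.real (Metric.ball (0 : Euc n) 1) :=
    volume_real_ball_pos _ one_pos
  have hn' : (n : ℝ) ≠ 0 := by positivity
  have := h.symm
  rw [mul_eq_zero, or_iff_right hn', smul_eq_zero, or_iff_right hV.ne'] at this
  exact this

theorem avgKernel_nonneg (hn : 1 ≤ n) (hσ : σ ∈ Set.Ioo (0 : ℝ) 1) (x : Euc n) :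
    0 ≤ avgKernel n σ x := by
  have : NeZero n := ⟨by omega⟩
  have : Nontrivial (Euc n) := inferInstance
  obtain ⟨e, he⟩ := exists_norm_eq (Euc n) zero_le_one
  rcases eq_or_ne x 0 with rfl | hx
  · refine setIntegral_nonneg measurableSet_Ioc fun s hs => ?_
    rw [smul_zero, smul_eq_mul]
    exact mul_nonneg (pow_nonneg hs.1.le _) (fracBump_zero_pos hn hσ).le
  · have h1 := setIntegral_ball_fracOp_nonneg hn hσ (contDiff_radialBump 2)
      hasCompactSupport_radialBump (fun _ _ => radialBump_mono) (norm_nonneg x)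
    have h2 := setIntegral_ball_fracBump (σ := σ) he hn (norm_nonneg x)
    rw [← norm_pow_mul_avgKernel he hn] at h2
    change 0 ≤ ∫ x in Metric.ball 0 ‖x‖, fracBump n σ x at h1
    rw [h2] at h1
    have hV : 0 < volume.real (Metric.ball (0 : Euc n) 1) :=
      volume_real_ball_pos _ one_pos
    have hx' : 0 < ‖x‖ := norm_pos_iff.2 hx
    have hn' : (0 : ℝ) < n := by exact_mod_cast hn
    rw [← mul_assoc] at h1
    exact nonneg_of_mul_nonneg_right h1 (by positivity)

theorem avgKernel_zero_pos (hn : 1 ≤ n) (hσ : σ ∈ Set.Ioo (0 : ℝ) 1) :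
    0 < avgKernel n σ 0 := by
  unfold avgKernel
  rw [← intervalIntegral.integral_of_le zero_le_one]
  simp only [smul_zero, smul_eq_mul]
  rw [intervalIntegral.integral_mul_const, integral_pow, Nat.sub_add_cancel hn]
  have := fracBump_zero_pos hn hσ
  have hn' : (0 : ℝ) < n := by exact_mod_cast hn
  have : (0 : ℝ) < ((n - 1 : ℕ) : ℝ) + 1 := by positivity
  simp only [one_pow, zero_pow (by omega : n ≠ 0), sub_zero]
  positivity

theorem exists_norm_avgKernel_le (hn : 1 ≤ n) (hσ : σ ∈ Set.Ioo (0 : ℝ) 1) :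
    ∃ C : ℝ, 0 ≤ C ∧ ∀ x, ‖avgKernel n σ x‖ ≤ C * (1 + ‖x‖) ^ (-((n : ℝ) + 2 * σ)) := by
  have : NeZero n := ⟨by omega⟩
  have : Nontrivial (Euc n) := inferInstance
  obtain ⟨e, he⟩ := exists_norm_eq (Euc n) zero_le_one
  obtain ⟨hI, hI0⟩ := integral_Ioi_fracBump he hn hσ
  obtain ⟨h0, h1⟩ := hσ
  obtain ⟨C, hC0, hC'⟩ := exists_norm_iteratedFDeriv_fracBump_le (n := n) hn ⟨h0, h1⟩ 0
  set p : ℝ := (n : ℝ) + 2 * σ with hp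
  have hp0 : 0 < p := by positivity
  have hC : ∀ x, ‖fracBump n σ x‖ ≤ C * (1 + ‖x‖) ^ (-p) := fun x => by
    simpa only [norm_iteratedFDeriv_zero] using hC' x
  refine ⟨(C + C / (2 * σ)) * 2 ^ p, by positivity, fun x => ?_⟩
  have hx1 : 0 < 1 + ‖x‖ := by positivity
  rcases le_or_gt ‖x‖ 1 with hx | hx
  · have h2 : 1 ≤ 2 ^ p * (1 + ‖x‖) ^ (-p) := by
      rw [rpow_neg hx1.le, ← div_eq_mul_inv, one_le_div (by positivity)]
      exact rpow_le_rpow hx1.le (by linarith) hp0.le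
    have h3 : ‖avgKernel n σ x‖ ≤ C := by
      unfold avgKernel
      have := norm_setIntegral_le_of_norm_le_const (μ := volume) (s := Set.Ioc (0 : ℝ) 1) (C := C)
        (f := fun s : ℝ => s ^ (n - 1) • fracBump n σ (s • x)) (by simp) (fun s hs => ?_)
      · simpa using this
      · rw [norm_smul, norm_pow, norm_of_nonneg hs.1.le]
        calc s ^ (n - 1) * ‖fracBump n σ (s • x)‖ ≤ 1 * (C * 1) := by
              gcongr
              · exact pow_le_one₀ hs.1.le hs.2
              · refine (hC _).trans ?_
                gcongr
                exact rpow_le_one_of_one_le_of_nonpos (by simp) (by linarith)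
          _ = C := by ring
    calc _ ≤ C := h3
      _ ≤ (C + C / (2 * σ)) * (2 ^ p * (1 + ‖x‖) ^ (-p)) := by
          have : 0 ≤ C / (2 * σ) := by positivity
          nlinarith
      _ = _ := by ring
  · have hx0 : 0 < ‖x‖ := by linarith
    have hpw : ∀ t : ℝ, 0 < t → t ^ (n - 1) * t ^ (-p) = t ^ (-1 - 2 * σ) := fun t ht => by
      rw [← rpow_natCast t (n - 1), ← rpow_add ht, Nat.cast_sub hn, hp]
      congr 1
      push_cast
      ring
    have h3 : ‖x‖ ^ n * ‖avgKernel n σ x‖ ≤ C / (2 * σ) * ‖x‖ ^ (-(2 * σ)) := by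
      have e1 := norm_pow_mul_avgKernel (σ := σ) he hn x
      have e2 : ∫ t in (0 : ℝ)..‖x‖, t ^ (n - 1) • fracBump n σ (t • e) =
          -∫ t in Set.Ioi ‖x‖, t ^ (n - 1) • fracBump n σ (t • e) := by
        rw [intervalIntegral.integral_of_le hx0.le, eq_neg_iff_add_eq_zero]
        refine Eq.trans ?_ hI0
        rw [← Set.Ioc_union_Ioi_eq_Ioi hx0.le]
        exact (setIntegral_union Set.Ioc_disjoint_Ioi_same measurableSet_Ioi
          (hI.mono_set Set.Ioc_subset_Ioi_self)
          (hI.mono_set (Set.Ioi_subset_Ioi hx0.le))).symm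
      have e3 : ‖‖x‖ ^ n * avgKernel n σ x‖ = ‖x‖ ^ n * ‖avgKernel n σ x‖ := by
        rw [norm_mul, norm_pow, norm_norm]
      rw [← e3, e1, e2, norm_neg]
      have e4 : ∫ t in Set.Ioi ‖x‖, C * t ^ (-1 - 2 * σ) = C / (2 * σ) * ‖x‖ ^ (-(2 * σ)) := by
        rw [integral_const_mul, integral_Ioi_rpow_of_lt (by linarith) hx0]
        rw [show -1 - 2 * σ + 1 = -(2 * σ) by ring]
        field_simp
      rw [← e4]
      refine norm_integral_le_of_norm_le
        ((integrableOn_Ioi_rpow_of_lt (by linarith) hx0).const_mul _) ?_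
      filter_upwards [ae_restrict_mem measurableSet_Ioi] with t ht
      have ht0 : 0 < t := hx0.trans ht
      rw [norm_smul, norm_pow, norm_of_nonneg ht0.le, ← hpw t ht0]
      calc t ^ (n - 1) * ‖fracBump n σ (t • e)‖ ≤ t ^ (n - 1) * (C * t ^ (-p)) := by
            gcongr
            refine (hC _).trans ?_
            gcongr ?_ * ?_
            refine rpow_le_rpow_of_nonpos ht0 ?_ (by linarith)
            simp [norm_smul, he, abs_of_pos ht0]
        _ = _ := by ring
    have h4 : ‖x‖ ^ (-(2 * σ)) = ‖x‖ ^ n * ‖x‖ ^ (-p) := by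
      rw [← rpow_natCast ‖x‖ n, ← rpow_add hx0, hp]
      congr 1
      ring
    have h5 : ‖avgKernel n σ x‖ ≤ C / (2 * σ) * ‖x‖ ^ (-p) := by
      rw [h4] at h3
      refine le_of_mul_le_mul_left (h3.trans_eq ?_) (pow_pos hx0 n)
      ring
    have h6 : ‖x‖ ^ (-p) ≤ 2 ^ p * (1 + ‖x‖) ^ (-p) := by
      calc ‖x‖ ^ (-p) ≤ ((1 + ‖x‖) / 2) ^ (-p) :=
            rpow_le_rpow_of_nonpos (by positivity) (by linarith) (by linarith)
        _ = 2 ^ p * (1 + ‖x‖) ^ (-p) := by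
            rw [div_rpow hx1.le (by norm_num), rpow_neg (by norm_num : (0 : ℝ) ≤ 2)]
            field_simp
    calc _ ≤ C / (2 * σ) * ‖x‖ ^ (-p) := h5
      _ ≤ (C + C / (2 * σ)) * (2 ^ p * (1 + ‖x‖) ^ (-p)) := by
          gcongr
          linarith
      _ = _ := by ring

theorem exists_norm_iteratedFDeriv_avgKernel_le (hn : 1 ≤ n) (hσ : σ ∈ Set.Ioo (0 : ℝ) 1) (m : ℕ) :
    ∃ C : ℝ, 0 ≤ C ∧ ∀ x, ‖iteratedFDeriv ℝ m (avgKernel n σ) x‖ ≤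
      C * (1 + ‖x‖) ^ (-((n : ℝ) + 2 * σ)) := by
  obtain ⟨C0, hC0', hC0⟩ := exists_norm_avgKernel_le hn hσ
  rcases le_or_gt 2 m with hm | hm
  · exact exists_norm_iteratedFDeriv_avgKernel_le_of_two_le hn hσ hm
  interval_cases m
  · exact ⟨C0, hC0', fun x => by simpa only [norm_iteratedFDeriv_zero] using hC0 x⟩
  obtain ⟨C2, hC2', hC2⟩ := exists_norm_iteratedFDeriv_avgKernel_le_of_two_le hn hσ le_rfl
  have hp0 : 0 < (n : ℝ) + 2 * σ := by have := hσ.1; positivity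
  set p : ℝ := (n : ℝ) + 2 * σ with hp
  have hcd := (contDiff_avgKernel (σ := σ) hn hσ 2).1
  refine ⟨2 ^ p * (2 * C0 + C2) * 2, by positivity, fun x => ?_⟩
  have hx1 : 0 < 1 + ‖x‖ := by positivity
  rw [norm_iteratedFDeriv_one]
  have hdec : ∀ y, ‖y - x‖ ≤ 1 / 2 → (1 + ‖y‖) ^ (-p) ≤ 2 ^ p * (1 + ‖x‖) ^ (-p) := by
    intro y hy
    have h1 : ‖x‖ ≤ ‖y‖ + 1 / 2 := by
      have := norm_sub_norm_le x y
      rw [norm_sub_rev] at this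
      linarith
    calc (1 + ‖y‖) ^ (-p) ≤ ((1 + ‖x‖) / 2) ^ (-p) :=
          rpow_le_rpow_of_nonpos (by positivity) (by linarith [norm_nonneg x, norm_nonneg y])
            (by linarith)
      _ = 2 ^ p * (1 + ‖x‖) ^ (-p) := by
          rw [div_rpow hx1.le (by norm_num), rpow_neg (by norm_num : (0 : ℝ) ≤ 2)]
          field_simp
  set D := 2 ^ p * (1 + ‖x‖) ^ (-p) with hD
  have hD0 : 0 ≤ D := by positivity
  have hd : Differentiable ℝ (avgKernel n σ) := hcd.differentiable (by norm_num)
  have hd1 : ContDiff ℝ 1 (fderiv ℝ (avgKernel n σ)) := hcd.fderiv_right (by norm_num)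
  have hlip : ∀ y ∈ Metric.closedBall x (1 / 2), ‖fderiv ℝ (avgKernel n σ) y -
      fderiv ℝ (avgKernel n σ) x‖ ≤ C2 * D * (1 / 2) := by
    intro y hy
    have hy' := mem_closedBall_iff_norm.1 hy
    refine (Convex.norm_image_sub_le_of_norm_fderiv_le (𝕜 := ℝ) (f := fderiv ℝ (avgKernel n σ))
      (C := C2 * D) (fun z _ => (hd1.differentiable (by norm_num)) z) (fun z hz => ?_)
      (convex_closedBall x (1 / 2)) (Metric.mem_closedBall_self (by norm_num)) hy).trans
      (by gcongr)
    have h2 := hC2 z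
    rw [← norm_iteratedFDeriv_fderiv, norm_iteratedFDeriv_one] at h2
    refine h2.trans ?_
    gcongr
    exact hdec z (mem_closedBall_iff_norm.1 hz)
  refine ContinuousLinearMap.opNorm_le_of_unit_norm (𝕜 := ℝ) (by positivity) fun v hv => ?_
  have hv2 : ‖(1 / 2 : ℝ) • v‖ = 1 / 2 := by rw [norm_smul, hv]; norm_num
  have hmem : x + (1 / 2 : ℝ) • v ∈ Metric.closedBall x (1 / 2) := by
    rw [mem_closedBall_iff_norm, add_sub_cancel_left, hv2]
  have key := Convex.norm_image_sub_le_of_norm_fderiv_le' (𝕜 := ℝ) (f := avgKernel n σ)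
    (φ := fderiv ℝ (avgKernel n σ) x) (fun z _ => hd z) hlip
    (convex_closedBall x (1 / 2)) (Metric.mem_closedBall_self (by norm_num)) hmem
  rw [add_sub_cancel_left, hv2, map_smul] at key
  have b1 := (hC0 (x + (1 / 2 : ℝ) • v)).trans
    (mul_le_mul_of_nonneg_left (hdec _ (by rw [add_sub_cancel_left, hv2])) hC0')
  have b2 := (hC0 x).trans (mul_le_mul_of_nonneg_left (hdec x (by simp)) hC0')
  have b3 : ‖(1 / 2 : ℝ) • fderiv ℝ (avgKernel n σ) x v‖ = 1 / 2 * ‖fderiv ℝ (avgKernel n σ) x v‖ := by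
    rw [norm_smul]; norm_num
  have b4 : ‖(1 / 2 : ℝ) • fderiv ℝ (avgKernel n σ) x v‖ ≤ C2 * D * (1 / 2) * (1 / 2) + C0 * D + C0 * D := by
    set a := avgKernel n σ (x + (1 / 2 : ℝ) • v)
    set b := avgKernel n σ x
    set c := (1 / 2 : ℝ) • fderiv ℝ (avgKernel n σ) x v
    have : c = -(a - b - c) + a - b := by ring
    rw [this]
    refine (norm_sub_le _ _).trans ?_
    gcongr
    refine (norm_add_le _ _).trans ?_
    rw [norm_neg]
    gcongr
  rw [b3] at b4
  have : 0 ≤ C0 * D := by positivity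
  have : 0 ≤ C2 * D := by positivity
  calc _ ≤ (2 * C0 + C2) * D * 2 := by nlinarith
    _ = _ := by rw [hD]; ring

end Kernel

section Step

variable {n : ℕ} {σ : ℝ}

theorem integrable_avgKernel (hn : 1 ≤ n) (hσ : σ ∈ Set.Ioo (0 : ℝ) 1) :
    Integrable (avgKernel n σ) := by
  obtain ⟨C, hC0, hC⟩ := exists_norm_avgKernel_le hn hσ
  refine ((integrable_one_add_norm (E := Euc n) (r := (n : ℝ) + 2 * σ) ?_).const_mul C).mono'
    (contDiff_avgKernel hn hσ 0).1.continuous.aestronglyMeasurable (Eventually.of_forall hC)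
  have := hσ.1
  simp
  positivity

theorem integral_avgKernel_pos (hn : 1 ≤ n) (hσ : σ ∈ Set.Ioo (0 : ℝ) 1) :
    0 < ∫ x, avgKernel n σ x :=
  integral_pos_of_integrable_nonneg_nonzero (x := 0) (contDiff_avgKernel hn hσ 0).1.continuous
    (integrable_avgKernel hn hσ) (avgKernel_nonneg hn hσ)
    (ne_of_gt (avgKernel_zero_pos hn hσ))

/-- The compactly supported kernel whose fractional Laplacian is the difference of two consecutive
dyadic dilations of `avgKernel`. -/
noncomputable def stepKernel (n : ℕ) (σ : ℝ) (x : Euc n) : ℝ :=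
  ∫ s in Set.Ioc (1 : ℝ) 2, s ^ ((n : ℝ) - 2 * σ - 1) • radialBump n (s • x)

theorem contDiff_stepKernel (m : ℕ) : ContDiff ℝ m (stepKernel n σ) := by
  choose C hC0 hC using fun j => exists_norm_le_of_hasCompactSupport
    ((contDiff_radialBump (n := n) j).continuous_iteratedFDeriv le_rfl)
    (hasCompactSupport_radialBump.iteratedFDeriv (𝕜 := ℝ) j)
  refine (contDiff_dilation (w := fun s => s ^ ((n : ℝ) - 2 * σ - 1)) measurableSet_Ioc
    (fun s hs => ⟨by linarith [hs.1], hs.2⟩) ?_ contDiff_radialBump hC m).1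
  have h : ContinuousOn (fun s : ℝ => s ^ ((n : ℝ) - 2 * σ - 1)) (Set.Icc 1 2) :=
    fun s hs => (continuousAt_rpow_const _ _
      (Or.inl (by linarith [hs.1] : s ≠ 0))).continuousWithinAt
  exact (h.integrableOn_compact isCompact_Icc).mono_set Set.Ioc_subset_Icc_self

theorem stepKernel_eq_zero {x : Euc n} (h : 1 / 2 ≤ ‖x‖) : stepKernel n σ x = 0 := by
  refine setIntegral_eq_zero_of_forall_eq_zero fun s hs => ?_
  rw [radialBump_eq_zero, smul_zero]
  rw [norm_smul, norm_of_nonneg (by linarith [hs.1])]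
  nlinarith [hs.1]

theorem two_pow_mul_avgKernel_two_smul (hn : 1 ≤ n) (x : Euc n) :
    2 ^ n * avgKernel n σ ((2 : ℝ) • x) =
      ∫ s in (0 : ℝ)..2, s ^ (n - 1) • fracBump n σ (s • x) := by
  have h := intervalIntegral.smul_integral_comp_mul_right (a := 0) (b := 1)
    (fun t : ℝ => t ^ (n - 1) • fracBump n σ (t • x)) 2
  rw [zero_mul, one_mul] at h
  rw [← h, avgKernel, ← intervalIntegral.integral_of_le zero_le_one, smul_eq_mul,
    ← intervalIntegral.integral_const_mul, ← intervalIntegral.integral_const_mul]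
  congr 1
  ext s
  obtain ⟨k, rfl⟩ : ∃ k, n = k + 1 := ⟨n - 1, by omega⟩
  simp only [smul_eq_mul, Nat.add_sub_cancel, smul_smul]
  ring

theorem fracOp_stepKernel (hn : 1 ≤ n) (hσ : σ ∈ Set.Ioo (0 : ℝ) 1) (x : Euc n) :
    fracOp n σ (stepKernel n σ) x = 2 ^ n * avgKernel n σ ((2 : ℝ) • x) - avgKernel n σ x := by
  have hfb : Continuous (fracBump n σ) := (contDiff_fracBump hn hσ 0).continuous
  have hrb : Continuous (radialBump n) := (contDiff_radialBump 0).continuous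
  have hci : Continuous (fun s : ℝ => s ^ (n - 1) • fracBump n σ (s • x)) := by fun_prop
  have e1 : 2 ^ n * avgKernel n σ ((2 : ℝ) • x) - avgKernel n σ x =
      ∫ s in Set.Ioc (1 : ℝ) 2, s ^ (n - 1) • fracBump n σ (s • x) := by
    rw [two_pow_mul_avgKernel_two_smul hn, avgKernel, ← intervalIntegral.integral_of_le zero_le_one,
      ← intervalIntegral.integral_of_le one_le_two]
    exact intervalIntegral.integral_interval_sub_left (hci.intervalIntegrable _ _)
      (hci.intervalIntegrable _ _)
  have e2 : ∀ s : ℝ, 0 < s → fracOp n σ (fun y => radialBump n (s • y)) x =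
      s ^ (2 * σ) * fracBump n σ (s • x) := by
    intro s hs
    have h := fracOp_comp_smul_sub (σ := σ) (radialBump n) hs (0 : Euc n) x
    have h1 : (fun y : Euc n => radialBump n (s • (0 - y))) = fun y => radialBump n (s • y) := by
      ext y
      exact radialBump_eq_of_norm_eq (by simp [norm_smul])
    rw [h1] at h
    rw [h, smul_eq_mul]
    congr 1
    exact fracBump_eq_of_norm_eq (by simp [norm_smul])
  have e3 : ∀ s ∈ Set.Ioc (1 : ℝ) 2, s ^ (n - 1) • fracBump n σ (s • x) =
      ∫ z : Euc n, s ^ ((n : ℝ) - 2 * σ - 1) * (‖z‖ ^ (-((n : ℝ) + 2 * σ)) •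
        secondDiff (fun y => radialBump n (s • y)) x z) := by
    intro s hs
    have hs0 : 0 < s := by linarith [hs.1]
    rw [integral_const_mul]
    have h := e2 s hs0
    rw [fracOp] at h
    rw [h, ← mul_assoc, ← rpow_add hs0, smul_eq_mul, ← rpow_natCast s (n - 1), Nat.cast_sub hn]
    congr 2
    push_cast
    ring
  obtain ⟨B, hB0, hB⟩ := exists_norm_secondDiff_le (contDiff_radialBump (n := n) 2)
    hasCompactSupport_radialBump
  have hprod : Integrable (Function.uncurry fun (z : Euc n) (s : ℝ) =>
      s ^ ((n : ℝ) - 2 * σ - 1) * (‖z‖ ^ (-((n : ℝ) + 2 * σ)) •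
        secondDiff (fun y => radialBump n (s • y)) x z))
      (volume.prod (volume.restrict (Set.Ioc (1 : ℝ) 2))) := by
    have hw : IntegrableOn (fun s : ℝ => s ^ ((n : ℝ) - 2 * σ - 1)) (Set.Ioc 1 2) := by
      have h : ContinuousOn (fun s : ℝ => s ^ ((n : ℝ) - 2 * σ - 1)) (Set.Icc 1 2) :=
        fun s hs => (continuousAt_rpow_const _ _
          (Or.inl (by linarith [hs.1] : s ≠ 0))).continuousWithinAt
      exact (h.integrableOn_compact isCompact_Icc).mono_set Set.Ioc_subset_Icc_self
    refine (((integrable_min_one_sq_mul_rpow hn hσ).const_mul (4 * B)).mul_prod hw).mono' ?_ ?_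
    · unfold secondDiff
      exact (by fun_prop : Measurable _).aestronglyMeasurable
    · have : ∀ᵐ q : Euc n × ℝ ∂(volume.prod (volume.restrict (Set.Ioc (1 : ℝ) 2))),
          q.2 ∈ Set.Ioc (1 : ℝ) 2 :=
        Measure.quasiMeasurePreserving_snd.ae (ae_restrict_mem measurableSet_Ioc)
      filter_upwards [this] with q hq
      obtain ⟨z, s⟩ := q
      have hs0 : 0 < s := by linarith [hq.1]
      have h1 : secondDiff (fun y => radialBump n (s • y)) x z =
          secondDiff (radialBump n) (s • x) (s • z) := by
        simp [secondDiff, smul_add, smul_sub]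
      have h2 := hB (s • x) (s • z)
      have h3 : min 1 (‖s • z‖ ^ 2) ≤ 4 * min 1 (‖z‖ ^ 2) := by
        rw [norm_smul, norm_of_nonneg hs0.le, mul_min_of_nonneg _ _ (by norm_num)]
        refine min_le_min (by norm_num) ?_
        rw [mul_pow]
        gcongr
        nlinarith [hq.2]
      have h4 : (0 : ℝ) ≤ ‖z‖ ^ (-((n : ℝ) + 2 * σ)) := by positivity
      have h5 : (0 : ℝ) ≤ s ^ ((n : ℝ) - 2 * σ - 1) := by positivity
      simp only [Function.uncurry_apply_pair]
      rw [h1, norm_mul, norm_smul, norm_of_nonneg h4, norm_of_nonneg h5]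
      calc _ ≤ s ^ ((n : ℝ) - 2 * σ - 1) * (‖z‖ ^ (-((n : ℝ) + 2 * σ)) *
            (B * (4 * min 1 (‖z‖ ^ 2)))) := by
              gcongr
              exact h2.trans (by gcongr)
        _ = _ := by ring
  rw [e1, setIntegral_congr_fun measurableSet_Ioc e3, ← integral_integral_swap hprod]
  unfold fracOp
  congr 1
  ext z
  have hI : ∀ y : Euc n, Integrable (fun s : ℝ => s ^ ((n : ℝ) - 2 * σ - 1) * radialBump n (s • y))
      (volume.restrict (Set.Ioc 1 2)) := by
    intro y
    have h : ContinuousOn (fun s : ℝ => s ^ ((n : ℝ) - 2 * σ - 1) * radialBump n (s • y))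
        (Set.Icc 1 2) := by
      refine ContinuousOn.mul (fun s hs => (continuousAt_rpow_const _ _
        (Or.inl (by linarith [hs.1] : s ≠ 0))).continuousWithinAt) ?_
      exact (by fun_prop : Continuous fun s : ℝ => radialBump n (s • y)).continuousOn
    exact (h.integrableOn_compact isCompact_Icc).mono_set Set.Ioc_subset_Icc_self
  have e4 : secondDiff (stepKernel n σ) x z = ∫ s in Set.Ioc (1 : ℝ) 2,
      s ^ ((n : ℝ) - 2 * σ - 1) * secondDiff (fun y => radialBump n (s • y)) x z := by
    have i4 : Integrable (fun s : ℝ => 2 * (s ^ ((n : ℝ) - 2 * σ - 1) * radialBump n (s • x)) -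
      s ^ ((n : ℝ) - 2 * σ - 1) * radialBump n (s • (x + z))) (volume.restrict (Set.Ioc 1 2)) :=
      ((hI x).const_mul 2).sub (hI (x + z))
    simp only [secondDiff, stepKernel, smul_eq_mul]
    rw [← integral_const_mul, ← integral_sub ((hI x).const_mul 2) (hI _), ← integral_sub i4 (hI _)]
    congr 1
    ext s
    ring
  rw [e4, smul_eq_mul, ← integral_const_mul]
  congr 1
  ext s
  simp only [smul_eq_mul]
  ring

end Step

section Dyadic

variable {n : ℕ} {σ : ℝ}

theorem one_add_rpow_neg_le {p t : ℝ} (hp : 0 < p) (ht : 0 ≤ t) :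
    (1 + t) ^ (-p) ≤ 2 / (1 + t ^ p) := by
  rw [rpow_neg (by positivity), ← one_div, div_le_div_iff₀ (by positivity) (by positivity)]
  have h1 : t ^ p ≤ (1 + t) ^ p := rpow_le_rpow ht (by linarith) hp.le
  have h2 : 1 ≤ (1 + t) ^ p := one_le_rpow (by linarith) hp.le
  linarith

theorem MemLσ.integrable_weight (hσ : σ ∈ Set.Ioo (0 : ℝ) 1) {u : Euc n → ℝ} (hu : MemLσ n σ u) :
    Integrable (fun y => |u y| * (1 + ‖y‖) ^ (-((n : ℝ) + 2 * σ))) ∧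
      ∫ y, |u y| * (1 + ‖y‖) ^ (-((n : ℝ) + 2 * σ)) ≤
        2 * ∫ y, |u y| / (1 + ‖y‖ ^ ((n : ℝ) + 2 * σ)) := by
  have hp : 0 < (n : ℝ) + 2 * σ := by have := hσ.1; positivity
  have hle : ∀ y : Euc n, |u y| * (1 + ‖y‖) ^ (-((n : ℝ) + 2 * σ)) ≤
      2 * (|u y| / (1 + ‖y‖ ^ ((n : ℝ) + 2 * σ))) := fun y => by
    calc _ ≤ |u y| * (2 / (1 + ‖y‖ ^ ((n : ℝ) + 2 * σ))) := by
          gcongr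
          exact one_add_rpow_neg_le hp (norm_nonneg y)
      _ = _ := by ring
  have hi : Integrable (fun y => |u y| * (1 + ‖y‖) ^ (-((n : ℝ) + 2 * σ))) := by
    refine (hu.2.const_mul 2).mono' ?_ (Eventually.of_forall fun y => ?_)
    · exact hu.1.aestronglyMeasurable.norm.mul
        (by fun_prop : Measurable fun y : Euc n => (1 + ‖y‖) ^
          (-((n : ℝ) + 2 * σ))).aestronglyMeasurable
    · rw [norm_of_nonneg (by positivity)]
      exact hle y
  exact ⟨hi, (integral_mono hi (hu.2.const_mul 2) hle).trans_eq (integral_const_mul _ _)⟩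

theorem one_add_norm_smul_sub_rpow_neg_le {p : ℝ} (hp : 0 < p) {r : ℝ} (hr : 1 ≤ r) {x : Euc n}
    (hx : ‖x‖ ≤ 1) (y : Euc n) : (1 + ‖r • (x - y)‖) ^ (-p) ≤ 2 ^ p * (1 + ‖y‖) ^ (-p) := by
  have h1 : ‖y‖ ≤ ‖x‖ + ‖x - y‖ := by
    have := norm_sub_le x (x - y)
    rwa [sub_sub_cancel] at this
  have h2 : ‖x - y‖ ≤ ‖r • (x - y)‖ := by
    rw [norm_smul, norm_of_nonneg (by linarith)]
    exact le_mul_of_one_le_left (norm_nonneg _) hr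
  calc (1 + ‖r • (x - y)‖) ^ (-p) ≤ ((1 + ‖y‖) / 2) ^ (-p) :=
        rpow_le_rpow_of_nonpos (by positivity) (by linarith [norm_nonneg (x - y)]) (by linarith)
    _ = 2 ^ p * (1 + ‖y‖) ^ (-p) := by
        rw [div_rpow (by positivity) (by norm_num), rpow_neg (by norm_num : (0 : ℝ) ≤ 2)]
        field_simp

theorem continuous_avgKernel (hn : 1 ≤ n) (hσ : σ ∈ Set.Ioo (0 : ℝ) 1) :
    Continuous (avgKernel n σ) := (contDiff_avgKernel hn hσ 0).1.continuous

theorem integrable_mul_avgKernel (hn : 1 ≤ n) (hσ : σ ∈ Set.Ioo (0 : ℝ) 1) {u : Euc n → ℝ}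
    (hu : MemLσ n σ u) {r : ℝ} (hr : 1 ≤ r) {x : Euc n} (hx : ‖x‖ ≤ 1) :
    Integrable (fun y => u y * avgKernel n σ (r • (x - y))) := by
  obtain ⟨C, hC0, hC⟩ := exists_norm_avgKernel_le hn hσ
  have hp : 0 < (n : ℝ) + 2 * σ := by have := hσ.1; positivity
  have hK := continuous_avgKernel hn hσ
  refine ((hu.integrable_weight hσ).1.const_mul (C * 2 ^ ((n : ℝ) + 2 * σ))).mono' ?_ ?_
  · exact hu.1.aestronglyMeasurable.mul (by fun_prop : Continuous fun y : Euc n =>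
      avgKernel n σ (r • (x - y))).aestronglyMeasurable
  · refine Eventually.of_forall fun y => ?_
    rw [norm_mul, norm_eq_abs]
    calc _ ≤ |u y| * (C * (2 ^ ((n : ℝ) + 2 * σ) * (1 + ‖y‖) ^ (-((n : ℝ) + 2 * σ)))) := by
          gcongr
          refine (hC _).trans ?_
          gcongr
          exact one_add_norm_smul_sub_rpow_neg_le hp hr hx y
      _ = _ := by ring

/-- The mollification of `u` at scale `2 ^ (-j)` by `avgKernel`. -/
noncomputable def dyadicAvg (n : ℕ) (σ : ℝ) (u : Euc n → ℝ) (j : ℕ) (x : Euc n) : ℝ :=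
  ∫ y, u y * (((2 : ℝ) ^ j) ^ n * avgKernel n σ ((2 : ℝ) ^ j • (x - y)))

/-- The mollification of `f` at scale `2 ^ (-j)` by `stepKernel`. -/
noncomputable def dyadicLayer (n : ℕ) (σ : ℝ) (f : Euc n → ℝ) (j : ℕ) (x : Euc n) : ℝ :=
  ∫ y in Metric.ball 0 2, f y * (((2 : ℝ) ^ j) ^ n * stepKernel n σ ((2 : ℝ) ^ j • (x - y)))

theorem tsupport_stepKernel_comp_subset {r : ℝ} (hr : 1 ≤ r) {x : Euc n} :
    tsupport (fun y => stepKernel n σ (r • (x - y))) ⊆ Metric.closedBall x (1 / 2) := by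
  refine closure_minimal (fun y hy => ?_) Metric.isClosed_closedBall
  by_contra h
  rw [mem_closedBall_iff_norm', not_le] at h
  refine hy (stepKernel_eq_zero ?_)
  rw [norm_smul, norm_of_nonneg (by linarith)]
  nlinarith

theorem contDiff_stepKernel_top : ContDiff ℝ (⊤ : ℕ∞) (stepKernel n σ) :=
  contDiff_infty.2 contDiff_stepKernel

theorem dyadicAvg_succ (hn : 1 ≤ n) (hσ : σ ∈ Set.Ioo (0 : ℝ) 1) {u f : Euc n → ℝ}
    (hu : MemLσ n σ u)
    (heq : ∀ φ : EuclideanSpace ℝ (Fin n) → ℝ, ContDiff ℝ (⊤ : ℕ∞) φ → HasCompactSupport φ →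
      tsupport φ ⊆ Metric.ball 0 2 → ∫ x, u x * fracLap n σ φ x = ∫ x, f x * φ x)
    (j : ℕ) {x : Euc n} (hx : x ∈ Metric.ball (0 : Euc n) 1) :
    dyadicAvg n σ u (j + 1) x = dyadicAvg n σ u j x +
      2 / fracConst n σ * (((2 : ℝ) ^ j)⁻¹ ^ (2 * σ) * dyadicLayer n σ f j x) := by
  obtain ⟨r, hr⟩ : ∃ r : ℝ, r = 2 ^ j := ⟨_, rfl⟩
  have hr1 : 1 ≤ r := hr ▸ one_le_pow₀ one_le_two
  have hr0 : 0 < r := by linarith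
  have hx1 : ‖x‖ < 1 := by simpa using hx
  have hc := fracConst_pos (n := n) hσ
  have hts := tsupport_stepKernel_comp_subset (n := n) (σ := σ) hr1 (x := x)
  have hsub : Metric.closedBall x (1 / 2) ⊆ Metric.ball 0 2 := by
    intro y hy
    rw [mem_closedBall_iff_norm] at hy
    rw [mem_ball_zero_iff]
    have := norm_add_le (y - x) x
    rw [sub_add_cancel] at this
    linarith
  have hcs : HasCompactSupport (fun y => stepKernel n σ (r • (x - y))) :=
    IsCompact.of_isClosed_subset (isCompact_closedBall x (1 / 2)) isClosed_closure hts
  have hcd : ContDiff ℝ (⊤ : ℕ∞) (fun y => stepKernel n σ (r • (x - y))) := by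
    have := contDiff_stepKernel_top (n := n) (σ := σ)
    fun_prop
  have h := heq _ hcd hcs (hts.trans hsub)
  have e1 : ∀ y, fracLap n σ (fun y => stepKernel n σ (r • (x - y))) y =
      fracConst n σ / 2 * (r ^ (2 * σ) * (2 ^ n * avgKernel n σ ((2 * r) • (x - y)) -
        avgKernel n σ (r • (x - y)))) := by
    intro y
    rw [fracLap_eq_fracOp hn hσ (contDiff_infty.1 hcd 2) hcs,
      fracOp_comp_smul_sub _ hr0, fracOp_stepKernel hn hσ, smul_smul, smul_eq_mul]
  simp only [e1] at h
  have e2 : ∫ y, f y * stepKernel n σ (r • (x - y)) =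
      ∫ y in Metric.ball 0 2, f y * stepKernel n σ (r • (x - y)) := by
    refine (setIntegral_eq_integral_of_forall_compl_eq_zero fun y hy => ?_).symm
    rw [image_eq_zero_of_notMem_tsupport (f := fun y => stepKernel n σ (r • (x - y)))
      fun h' => hy (hsub (hts h')), mul_zero]
  rw [e2] at h
  have i1 := integrable_mul_avgKernel hn hσ hu (r := 2 * r) (by linarith) hx1.le
  have i2 := integrable_mul_avgKernel hn hσ hu hr1 hx1.le
  have e3 : ∫ y, u y * (fracConst n σ / 2 * (r ^ (2 * σ) *
      (2 ^ n * avgKernel n σ ((2 * r) • (x - y)) - avgKernel n σ (r • (x - y))))) =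
      fracConst n σ / 2 * r ^ (2 * σ) * (2 ^ n * (∫ y, u y * avgKernel n σ ((2 * r) • (x - y))) -
        ∫ y, u y * avgKernel n σ (r • (x - y))) := by
    rw [← integral_const_mul (2 ^ n : ℝ), ← integral_sub (i1.const_mul _) i2, ← integral_const_mul]
    congr 1
    ext y
    ring
  rw [e3] at h
  have e4 : dyadicAvg n σ u (j + 1) x = (2 * r) ^ n * ∫ y, u y * avgKernel n σ ((2 * r) • (x - y)) := by
    rw [dyadicAvg, ← integral_const_mul, pow_succ', ← hr]
    congr 1
    ext y
    ring
  have e5 : dyadicAvg n σ u j x = r ^ n * ∫ y, u y * avgKernel n σ (r • (x - y)) := by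
    rw [dyadicAvg, ← integral_const_mul, ← hr]
    congr 1
    ext y
    ring
  have e6 : dyadicLayer n σ f j x =
      r ^ n * ∫ y in Metric.ball 0 2, f y * stepKernel n σ (r • (x - y)) := by
    rw [dyadicLayer, ← integral_const_mul, ← hr]
    congr 1
    ext y
    ring
  rw [e4, e5, e6, ← h, ← hr, inv_rpow hr0.le, mul_pow]
  have : 0 < r ^ (2 * σ) := by positivity
  field_simp
  ring

theorem dyadicAvg_eq_sum (hn : 1 ≤ n) (hσ : σ ∈ Set.Ioo (0 : ℝ) 1) {u f : Euc n → ℝ}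
    (hu : MemLσ n σ u)
    (heq : ∀ φ : EuclideanSpace ℝ (Fin n) → ℝ, ContDiff ℝ (⊤ : ℕ∞) φ → HasCompactSupport φ →
      tsupport φ ⊆ Metric.ball 0 2 → ∫ x, u x * fracLap n σ φ x = ∫ x, f x * φ x)
    (J : ℕ) {x : Euc n} (hx : x ∈ Metric.ball (0 : Euc n) 1) :
    dyadicAvg n σ u J x = dyadicAvg n σ u 0 x +
      2 / fracConst n σ * ∑ j ∈ Finset.range J, ((2 : ℝ) ^ j)⁻¹ ^ (2 * σ) * dyadicLayer n σ f j x := by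
  induction J with
  | zero => simp
  | succ J ih =>
    rw [dyadicAvg_succ hn hσ hu heq J hx, ih, Finset.sum_range_succ]
    ring

/-- Testing the mollifications against `φ` recovers `u` in the limit. -/
theorem tendsto_integral_dyadicAvg_mul (hn : 1 ≤ n) (hσ : σ ∈ Set.Ioo (0 : ℝ) 1) {u : Euc n → ℝ}
    (hu : MemLσ n σ u) {φ : Euc n → ℝ} (hφ : Continuous φ)
    (hφs : tsupport φ ⊆ Metric.ball 0 1) :
    (∀ J, Integrable (fun x => dyadicAvg n σ u J x * φ x)) ∧
    Tendsto (fun J => ∫ x, dyadicAvg n σ u J x * φ x) atTop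
      (nhds (∫ y, u y * ((∫ z, avgKernel n σ z) * φ y))) := by
  obtain ⟨C, hC0, hC⟩ := exists_norm_avgKernel_le hn hσ
  obtain ⟨p, hp⟩ : ∃ p, p = (n : ℝ) + 2 * σ := ⟨_, rfl⟩
  rw [← hp] at hC
  have hp0 : 0 < p := by have := hσ.1; rw [hp]; positivity
  have hK := continuous_avgKernel hn hσ
  have hcs : HasCompactSupport φ := IsCompact.of_isClosed_subset (isCompact_closedBall 0 1)
    isClosed_closure (hφs.trans Metric.ball_subset_closedBall)
  have hφi : Integrable φ := hφ.integrable_of_hasCompactSupport hcs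
  obtain ⟨B, hB0, hB⟩ := exists_norm_le_of_hasCompactSupport hφ hcs
  have hφ0 : ∀ x, 1 < ‖x‖ → φ x = 0 := fun x hx => by
    by_contra h
    have := hφs (subset_tsupport _ h)
    rw [mem_ball_zero_iff] at this
    linarith
  have hw := (hu.integrable_weight hσ).1
  rw [← hp] at hw
  have hprod : ∀ J : ℕ, Integrable (Function.uncurry fun x y : Euc n =>
      u y * (((2 : ℝ) ^ J) ^ n * avgKernel n σ ((2 : ℝ) ^ J • (x - y))) * φ x)
      (volume.prod volume) := by
    intro J
    refine ((hφi.norm.mul_prod hw).const_mul (((2 : ℝ) ^ J) ^ n * (C * 2 ^ p))).mono' ?_ ?_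
    · refine (hu.1.aestronglyMeasurable.comp_snd.mul ?_).mul hφ.aestronglyMeasurable.comp_fst
      exact (by fun_prop : Continuous fun q : Euc n × Euc n =>
        ((2 : ℝ) ^ J) ^ n * avgKernel n σ ((2 : ℝ) ^ J • (q.1 - q.2))).aestronglyMeasurable
    · refine Eventually.of_forall fun ⟨x, y⟩ => ?_
      simp only [Function.uncurry_apply_pair]
      rcases le_or_gt ‖x‖ 1 with hx | hx
      · rw [norm_mul, norm_mul, norm_mul, norm_eq_abs (u y), norm_of_nonneg (by positivity)]
        calc _ ≤ |u y| * (((2 : ℝ) ^ J) ^ n * (C * (2 ^ p * (1 + ‖y‖) ^ (-p)))) * ‖φ x‖ := by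
              gcongr
              refine (hC _).trans ?_
              gcongr
              exact one_add_norm_smul_sub_rpow_neg_le hp0 (one_le_pow₀ one_le_two) hx y
          _ = _ := by ring
      · simp [hφ0 x hx]
  have e1 : ∀ J x, dyadicAvg n σ u J x * φ x =
      ∫ y, u y * (((2 : ℝ) ^ J) ^ n * avgKernel n σ ((2 : ℝ) ^ J • (x - y))) * φ x := fun J x => by
    rw [dyadicAvg, integral_mul_const]
  refine ⟨fun J =>
    (hprod J).integral_prod_left.congr (Eventually.of_forall fun x => (e1 J x).symm), ?_⟩
  have e2 : ∀ J y, ∫ x, u y * (((2 : ℝ) ^ J) ^ n * avgKernel n σ ((2 : ℝ) ^ J • (x - y))) * φ x =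
      u y * ∫ z, avgKernel n σ z * φ (y + ((2 : ℝ) ^ J)⁻¹ • z) := by
    intro J y
    have hpos : (0 : ℝ) < 2 ^ J := by positivity
    have h1 := Measure.integral_comp_smul_of_nonneg (volume : Measure (Euc n))
      (fun z => avgKernel n σ z * φ (y + ((2 : ℝ) ^ J)⁻¹ • z)) (2 ^ J) (hR := hpos.le)
    simp only [smul_smul, inv_mul_cancel₀ hpos.ne', one_smul, finrank_euclideanSpace,
      Fintype.card_fin, smul_eq_mul] at h1
    rw [eq_inv_mul_iff_mul_eq₀ (by positivity)] at h1
    rw [← h1, ← integral_sub_right_eq_self (fun x => avgKernel n σ ((2 : ℝ) ^ J • x) *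
      φ (y + x)) y, ← integral_const_mul, ← integral_const_mul]
    congr 1
    ext x
    rw [add_sub_cancel]
    ring
  have e3 : ∀ J, ∫ x, dyadicAvg n σ u J x * φ x =
      ∫ y, u y * ∫ z, avgKernel n σ z * φ (y + ((2 : ℝ) ^ J)⁻¹ • z) := by
    intro J
    simp only [e1]
    rw [integral_integral_swap (hprod J)]
    simp only [e2]
  simp only [e3]
  obtain ⟨L, hL⟩ : ∃ L, L = ∫ z, ‖avgKernel n σ z‖ := ⟨_, rfl⟩
  have hL0 : 0 ≤ L := hL ▸ integral_nonneg fun _ => norm_nonneg _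
  obtain ⟨Φ, hΦ⟩ : ∃ Φ, Φ = ∫ x, ‖φ x‖ := ⟨_, rfl⟩
  have hΦ0 : 0 ≤ Φ := hΦ ▸ integral_nonneg fun _ => norm_nonneg _
  have hKi := integrable_avgKernel (n := n) hn hσ
  have hφz : ∀ (J : ℕ) (y : Euc n), Continuous fun z : Euc n => φ (y + ((2 : ℝ) ^ J)⁻¹ • z) := by
    intro J y
    fun_prop
  have hb1 : ∀ J y, ‖∫ z, avgKernel n σ z * φ (y + ((2 : ℝ) ^ J)⁻¹ • z)‖ ≤ L * B := by
    intro J y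
    rw [hL, ← integral_mul_const]
    refine norm_integral_le_of_norm_le (hKi.norm.mul_const B) (Eventually.of_forall fun z => ?_)
    rw [norm_mul]
    gcongr
    exact hB _
  have hb2 : ∀ J y, 3 ≤ ‖y‖ → ‖∫ z, avgKernel n σ z * φ (y + ((2 : ℝ) ^ J)⁻¹ • z)‖ ≤
      C * 2 ^ p * Φ * (1 + ‖y‖) ^ (-p) := by
    intro J y hy
    have hpos : (1 : ℝ) ≤ 2 ^ J := one_le_pow₀ one_le_two
    obtain ⟨r, hr⟩ : ∃ r : ℝ, r = 2 ^ J := ⟨_, rfl⟩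
    rw [← hr] at hpos ⊢
    have hr0 : 0 < r := by linarith
    have h1 := Measure.integral_comp_smul_of_nonneg (volume : Measure (Euc n))
      (fun z => C * (r * ((1 + ‖y‖) / 2)) ^ (-p) * ‖φ (y + r⁻¹ • z)‖) r (hR := by linarith)
    simp only [smul_smul, inv_mul_cancel₀ hr0.ne', one_smul, finrank_euclideanSpace,
      Fintype.card_fin, smul_eq_mul] at h1
    rw [eq_inv_mul_iff_mul_eq₀ (by positivity), integral_const_mul,
      integral_add_left_eq_self (fun z => ‖φ z‖) y, ← hΦ] at h1
    have h2 : r ^ n * r ^ (-p) ≤ 1 := by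
      rw [← rpow_natCast, ← rpow_add hr0]
      exact rpow_le_one_of_one_le_of_nonpos hpos (by have := hσ.1; rw [hp]; linarith)
    calc _ ≤ ∫ z, C * (r * ((1 + ‖y‖) / 2)) ^ (-p) * ‖φ (y + r⁻¹ • z)‖ := by
          refine norm_integral_le_of_norm_le (Integrable.const_mul ?_ _)
            (Eventually.of_forall fun z => ?_)
          · exact ((hφi.comp_add_left y).comp_smul (R := r⁻¹) (by positivity)).norm
          · rw [norm_mul]
            rcases le_or_gt ‖y + r⁻¹ • z‖ 1 with h | h
            · gcongr
              refine (hC z).trans ?_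
              gcongr ?_ * ?_
              refine rpow_le_rpow_of_nonpos (by positivity) ?_ (by linarith)
              have h3 : ‖y‖ ≤ ‖y + r⁻¹ • z‖ + ‖r⁻¹ • z‖ := by
                simpa using norm_sub_le (y + r⁻¹ • z) (r⁻¹ • z)
              rw [norm_smul, norm_of_nonneg (by positivity)] at h3
              have h4 : (1 + ‖y‖) / 2 ≤ r⁻¹ * ‖z‖ := by linarith
              calc r * ((1 + ‖y‖) / 2) ≤ r * (r⁻¹ * ‖z‖) := by gcongr
                _ = ‖z‖ := by field_simp
                _ ≤ _ := by linarith
            · simp [hφ0 _ h]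
      _ = C * (r ^ n * r ^ (-p)) * ((1 + ‖y‖) / 2) ^ (-p) * Φ := by
          rw [← h1, mul_rpow hr0.le (by positivity)]
          ring
      _ ≤ C * 1 * ((1 + ‖y‖) / 2) ^ (-p) * Φ := by gcongr
      _ = _ := by
          rw [div_rpow (by positivity) (by norm_num), rpow_neg (by norm_num : (0 : ℝ) ≤ 2)]
          field_simp
  refine tendsto_integral_of_dominated_convergence
    (fun y => (L * B * 4 ^ p + C * 2 ^ p * Φ) * (|u y| * (1 + ‖y‖) ^ (-p))) ?_ (hw.const_mul _) ?_ ?_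
  · intro J
    have h1 := (hprod J).swap.integral_prod_left.aestronglyMeasurable
    simp only [Function.comp_def, Function.uncurry, Prod.swap, e2] at h1
    exact h1
  · intro J
    refine Eventually.of_forall fun y => ?_
    rw [norm_mul, norm_eq_abs (u y)]
    have hy0 : 0 ≤ (1 + ‖y‖) ^ (-p) := by positivity
    have : ‖∫ z, avgKernel n σ z * φ (y + ((2 : ℝ) ^ J)⁻¹ • z)‖ ≤
        (L * B * 4 ^ p + C * 2 ^ p * Φ) * (1 + ‖y‖) ^ (-p) := by
      rw [add_mul]
      rcases le_or_gt 3 ‖y‖ with hy | hy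
      · refine (hb2 J y hy).trans (le_add_of_nonneg_left (by positivity))
      · refine (hb1 J y).trans (le_trans ?_ (le_add_of_nonneg_right (by positivity)))
        have h2 : 1 ≤ 4 ^ p * (1 + ‖y‖) ^ (-p) := by
          rw [rpow_neg (by positivity), ← div_eq_mul_inv, one_le_div (by positivity)]
          exact rpow_le_rpow (by positivity) (by linarith) hp0.le
        calc L * B = L * B * 1 := by ring
          _ ≤ L * B * (4 ^ p * (1 + ‖y‖) ^ (-p)) := by gcongr
          _ = _ := by ring
    calc _ ≤ |u y| * ((L * B * 4 ^ p + C * 2 ^ p * Φ) * (1 + ‖y‖) ^ (-p)) := by gcongr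
      _ = _ := by ring
  · refine Eventually.of_forall fun y => Tendsto.const_mul _ ?_
    rw [← integral_mul_const]
    refine tendsto_integral_of_dominated_convergence (fun z => ‖avgKernel n σ z‖ * B)
      (fun J => (hK.mul (hφz J y)).aestronglyMeasurable) (hKi.norm.mul_const B) ?_ ?_
    · intro J
      refine Eventually.of_forall fun z => ?_
      rw [norm_mul]
      gcongr
      exact hB _
    · refine Eventually.of_forall fun z => Tendsto.const_mul _ ?_
      have h1 : Tendsto (fun J : ℕ => y + ((2 : ℝ) ^ J)⁻¹ • z) atTop (nhds (y + (0 : ℝ) • z)) := by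
        refine (Tendsto.smul_const ?_ z).const_add y
        simp only [← inv_pow]
        exact tendsto_pow_atTop_nhds_zero_of_lt_one (by norm_num) (by norm_num)
      rw [zero_smul, add_zero] at h1
      exact (hφ.tendsto y).comp h1

end Dyadic

section IteratedFDeriv

theorem norm_iteratedFDeriv_iteratedFDeriv {E : Type} [NormedAddCommGroup E] [NormedSpace ℝ E]
    (k : ℕ) : ∀ {F : Type} [NormedAddCommGroup F] [NormedSpace ℝ F] (f : E → F) (i : ℕ) (x : E),
    ‖iteratedFDeriv ℝ i (iteratedFDeriv ℝ k f) x‖ = ‖iteratedFDeriv ℝ (k + i) f x‖ := by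
  induction k with
  | zero =>
    intro F _ _ f i x
    rw [iteratedFDeriv_zero_eq_comp, LinearIsometryEquiv.norm_iteratedFDeriv_comp_left, zero_add]
  | succ k ih =>
    intro F _ _ f i x
    have h : iteratedFDeriv ℝ (k + 1) f = (continuousMultilinearCurryRightEquiv' ℝ k E F).symm ∘
        iteratedFDeriv ℝ k (fderiv ℝ f) := funext fun _ => iteratedFDeriv_succ_eq_comp_right
    have h' := LinearIsometryEquiv.norm_iteratedFDeriv_comp_left (𝕜 := ℝ)
      (F := E [×k]→L[ℝ] (E →L[ℝ] F)) (G := E [×(k + 1)]→L[ℝ] F)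
      (continuousMultilinearCurryRightEquiv' ℝ k E F).symm
      (iteratedFDeriv ℝ k (fderiv ℝ f)) x i
    rw [h, h', ih, norm_iteratedFDeriv_fderiv, add_right_comm]

end IteratedFDeriv

section DyadicSum

theorem summable_pow_natAbs {q : ℝ} (hq0 : 0 ≤ q) (hq1 : q < 1) :
    Summable fun i : ℤ => q ^ i.natAbs := by
  have h := summable_geometric_of_lt_one hq0 hq1
  exact Summable.of_nat_of_neg (by simpa using h) (by simpa using h)

/-- A series whose terms are controlled by two competing powers of the scale is controlled by the
balanced power. -/
theorem exists_tsum_le_rpow {a β : ℝ} (ha : 0 < a) (hβ : β < 1) :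
    ∃ C, 0 ≤ C ∧ ∀ (s : ℕ → ℝ) (K d : ℝ), 0 ≤ K → 0 < d → (∀ j, 0 ≤ s j) →
      (∀ j, s j ≤ K * (((2 : ℝ) ^ j)⁻¹ ^ a * d ^ (β - a))) →
      (∀ j, s j ≤ K * (d * ((2 : ℝ) ^ j)⁻¹ ^ (β - 1))) →
      Summable s ∧ ∑' j, s j ≤ C * K * d ^ β := by
  obtain ⟨b, hb⟩ : ∃ b, b = min a (1 - β) := ⟨_, rfl⟩
  have hb0 : 0 < b := by rw [hb]; exact lt_min ha (by linarith)
  have hba : b ≤ a := hb ▸ min_le_left _ _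
  have hbβ : b ≤ 1 - β := hb ▸ min_le_right _ _
  obtain ⟨q, hq⟩ : ∃ q : ℝ, q = 2 ^ (-b) := ⟨_, rfl⟩
  have hq0 : 0 < q := by rw [hq]; positivity
  have hq1 : q < 1 := by rw [hq]; exact rpow_lt_one_of_one_lt_of_neg one_lt_two (by linarith)
  have hs := summable_pow_natAbs hq0.le hq1
  have hqn : ∀ m : ℕ, q ^ m = 2 ^ (-(b * m)) := fun m => by
    rw [hq, ← rpow_natCast, ← rpow_mul (by norm_num)]
    ring_nf
  refine ⟨2 ^ (1 - β) * ∑' i : ℤ, q ^ i.natAbs, ?_, ?_⟩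
  · have : 0 ≤ ∑' i : ℤ, q ^ i.natAbs := tsum_nonneg fun i => by positivity
    positivity
  intro s K d hK hd hs0 h1 h2
  obtain ⟨m, hm1, hm2⟩ := exists_mem_Ico_zpow hd (one_lt_two (α := ℝ))
  rw [← rpow_intCast] at hm1 hm2
  have hr : ∀ j : ℕ, ((2 : ℝ) ^ j)⁻¹ = 2 ^ (-(j : ℝ)) := fun j => by
    rw [rpow_neg (by norm_num), rpow_natCast]
  have hrb : (1 : ℝ) ≤ 2 ^ (1 - β) := one_le_rpow one_le_two (by linarith)
  have key : ∀ j : ℕ, s j ≤ 2 ^ (1 - β) * K * d ^ β * q ^ ((j : ℤ) + m).natAbs := by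
    intro j
    rcases le_total 0 ((j : ℤ) + m) with hj | hj
    · have e : (((j : ℤ) + m).natAbs : ℝ) = j + m := by
        rw [Nat.cast_natAbs, abs_of_nonneg hj]
        push_cast
        rfl
      have hj' : (0 : ℝ) ≤ j + m := by exact_mod_cast hj
      have hda : d ^ (-a) ≤ (2 ^ (m : ℝ)) ^ (-a) :=
        rpow_le_rpow_of_nonpos (by positivity) hm1 (neg_nonpos.2 ha.le)
      calc s j ≤ K * (((2 : ℝ) ^ j)⁻¹ ^ a * d ^ (β - a)) := h1 j
        _ = 1 * K * d ^ β * (2 ^ (-(j : ℝ) * a) * d ^ (-a)) := by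
            rw [hr, ← rpow_mul (by norm_num), sub_eq_add_neg, rpow_add hd]
            ring
        _ ≤ 2 ^ (1 - β) * K * d ^ β * (2 ^ (-(j : ℝ) * a) * (2 ^ (m : ℝ)) ^ (-a)) := by
            gcongr
        _ ≤ _ := by
            rw [hqn, e, ← rpow_mul (by norm_num), ← rpow_add (by norm_num)]
            gcongr
            · norm_num
            · nlinarith
    · have e : (((j : ℤ) + m).natAbs : ℝ) = -(j + m) := by
        rw [Nat.cast_natAbs, abs_of_nonpos hj]
        push_cast
        rfl
      have hj' : (j : ℝ) + m ≤ 0 := by exact_mod_cast hj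
      calc s j ≤ K * (d * ((2 : ℝ) ^ j)⁻¹ ^ (β - 1)) := h2 j
        _ = K * d ^ β * (2 ^ (-(j : ℝ) * (β - 1)) * d ^ (1 - β)) := by
            have : d = d ^ β * d ^ (1 - β) := by
              rw [← rpow_add hd, add_sub_cancel, rpow_one]
            rw [hr, ← rpow_mul (by norm_num)]
            nth_rewrite 1 [this]
            ring
        _ ≤ K * d ^ β * (2 ^ (-(j : ℝ) * (β - 1)) * (2 ^ ((m + 1 : ℤ) : ℝ)) ^ (1 - β)) := by
            gcongr
        _ = 2 ^ (1 - β) * K * d ^ β * 2 ^ ((j + m) * (1 - β)) := by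
            rw [← rpow_mul (by norm_num), ← rpow_add (by norm_num)]
            have : -(j : ℝ) * (β - 1) + ((m + 1 : ℤ) : ℝ) * (1 - β) =
                (1 - β) + (j + m) * (1 - β) := by push_cast; ring
            rw [this, rpow_add (by norm_num)]
            ring
        _ ≤ _ := by
            rw [hqn, e]
            gcongr
            · norm_num
            · nlinarith
  have hinj : Function.Injective fun j : ℕ => (j : ℤ) + m := fun i j h => by simpa using h
  have hs' : Summable fun j : ℕ => q ^ ((j : ℤ) + m).natAbs := hs.comp_injective hinj
  have hsum := hs'.mul_left (2 ^ (1 - β) * K * d ^ β)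
  refine ⟨Summable.of_nonneg_of_le hs0 key hsum, ?_⟩
  have hS := Summable.of_nonneg_of_le hs0 key hsum
  calc ∑' j, s j ≤ ∑' j : ℕ, 2 ^ (1 - β) * K * d ^ β * q ^ ((j : ℤ) + m).natAbs :=
        hS.tsum_le_tsum key hsum
    _ = 2 ^ (1 - β) * K * d ^ β * ∑' j : ℕ, q ^ ((j : ℤ) + m).natAbs := tsum_mul_left
    _ ≤ 2 ^ (1 - β) * K * d ^ β * ∑' i : ℤ, q ^ i.natAbs := by
        gcongr
        exact tsum_comp_le_tsum_of_inj hs (fun i => by positivity) hinj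
    _ = _ := by ring

end DyadicSum

section KernelLayer

variable {n : ℕ} {V : Type} [NormedAddCommGroup V] [NormedSpace ℝ V]

/-- The convolution of `g`, cut off to the ball of radius `2`, with the kernel `Ψ` rescaled to
scale `r⁻¹`. -/
noncomputable def kernelLayer (Ψ : Euc n → ℝ) (r : ℝ) (g : Euc n → V) (x : Euc n) : V :=
  ∫ y in Metric.ball 0 2, (r ^ n * Ψ (r • (x - y))) • g y

theorem iteratedFDeriv_smul_const_of_contDiff {h : Euc n → ℝ} {m : ℕ} (hh : ContDiff ℝ m h) (c : V)
    (x : Euc n) : iteratedFDeriv ℝ m (fun x => h x • c) x =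
      ContinuousLinearMap.compContinuousMultilinearMapL ℝ (fun _ : Fin m => Euc n) ℝ V
        ((ContinuousLinearMap.lsmul ℝ ℝ : ℝ →L[ℝ] V →L[ℝ] V).flip c) (iteratedFDeriv ℝ m h x) :=
  ((ContinuousLinearMap.lsmul ℝ ℝ : ℝ →L[ℝ] V →L[ℝ] V).flip c).iteratedFDeriv_comp_left
    hh.contDiffAt le_rfl

theorem norm_iteratedFDeriv_smul_const_le {h : Euc n → ℝ} {m : ℕ} (hh : ContDiff ℝ m h) (c : V)
    (x : Euc n) : ‖iteratedFDeriv ℝ m (fun x => h x • c) x‖ ≤ ‖iteratedFDeriv ℝ m h x‖ * ‖c‖ := by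
  rw [iteratedFDeriv_smul_const_of_contDiff hh]
  refine (ContinuousLinearMap.norm_compContinuousMultilinearMap_le _ _).trans ?_
  rw [mul_comm]
  gcongr
  refine ContinuousLinearMap.opNorm_le_bound _ (norm_nonneg _) fun t => ?_
  simp [norm_smul, mul_comm]

theorem iteratedFDeriv_rescale {Ψ : Euc n → ℝ} {m : ℕ} (hΨ : ContDiff ℝ m Ψ) (r : ℝ) (x y : Euc n) :
    iteratedFDeriv ℝ m (fun x => r ^ n * Ψ (r • (x - y))) x =
      (r ^ n * r ^ m) • iteratedFDeriv ℝ m Ψ (r • (x - y)) := by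
  have h1 : iteratedFDeriv ℝ m (fun z => Ψ (r • z)) = fun z => r ^ m • iteratedFDeriv ℝ m Ψ (r • z) :=
    iteratedFDeriv_comp_const_smul r hΨ
  have h2 : ContDiff ℝ m (fun x => Ψ (r • (x - y))) := by fun_prop
  have h3 := iteratedFDeriv_const_smul_apply' (𝕜 := ℝ) (i := m) (a := r ^ n) (x := x) h2.contDiffAt
  simp only [smul_eq_mul] at h3
  rw [h3, iteratedFDeriv_comp_sub m y x (f := fun z => Ψ (r • z)), h1, smul_smul]

theorem iteratedFDeriv_eq_zero_of_half_lt {Ψ : Euc n → ℝ} (hΨ0 : ∀ x, 1 / 2 ≤ ‖x‖ → Ψ x = 0) (m : ℕ)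
    {x : Euc n} (hx : 1 / 2 < ‖x‖) : iteratedFDeriv ℝ m Ψ x = 0 := by
  have : tsupport Ψ ⊆ Metric.closedBall 0 (1 / 2) := by
    refine closure_minimal (fun y hy => ?_) Metric.isClosed_closedBall
    by_contra h
    rw [mem_closedBall_zero_iff, not_le] at h
    exact hy (hΨ0 y h.le)
  by_contra h
  have := this (support_iteratedFDeriv_subset (𝕜 := ℝ) (f := Ψ) m h)
  rw [mem_closedBall_zero_iff] at this
  linarith

theorem contDiff_kernelLayer [CompleteSpace V] {Ψ : Euc n → ℝ} (hΨ : ∀ m : ℕ, ContDiff ℝ m Ψ)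
    (hΨ0 : ∀ x, 1 / 2 ≤ ‖x‖ → Ψ x = 0) (r : ℝ) {g : Euc n → V} {B : ℝ}
    (hgm : AEStronglyMeasurable g (volume.restrict (Metric.ball 0 2)))
    (hg : ∀ y ∈ Metric.ball (0 : Euc n) 2, ‖g y‖ ≤ B) (m : ℕ) :
    ContDiff ℝ m (kernelLayer Ψ r g) ∧ ∀ x, iteratedFDeriv ℝ m (kernelLayer Ψ r g) x =
      ∫ y in Metric.ball 0 2, iteratedFDeriv ℝ m (fun x => (r ^ n * Ψ (r • (x - y))) • g y) x := by
  have hΨc : HasCompactSupport Ψ := by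
    refine HasCompactSupport.intro (isCompact_closedBall (0 : Euc n) (1 / 2)) fun x hx => hΨ0 x ?_
    rw [mem_closedBall_zero_iff, not_le] at hx
    exact hx.le
  have hb : ∀ j : ℕ, ∃ D, 0 ≤ D ∧ ∀ x, ‖iteratedFDeriv ℝ j Ψ x‖ ≤ D := fun j =>
    exists_norm_le_of_hasCompactSupport ((hΨ j).continuous_iteratedFDeriv le_rfl)
      (hΨc.iteratedFDeriv j)
  choose D hD0 hD using hb
  have hdiff : ∀ (j : ℕ) (y : Euc n), ContDiff ℝ j (fun x => r ^ n * Ψ (r • (x - y))) := by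
    intro j y
    have := hΨ j
    fun_prop
  have hf : ∀ y, ContDiffOn ℝ m (fun x => (r ^ n * Ψ (r • (x - y))) • g y) Set.univ := fun y =>
    ((hdiff m y).smul contDiff_const).contDiffOn
  have hmeas : ∀ j ≤ m, ∀ x ∈ (Set.univ : Set (Euc n)), AEStronglyMeasurable
      (fun y => iteratedFDeriv ℝ j (fun x => (r ^ n * Ψ (r • (x - y))) • g y) x)
      (volume.restrict (Metric.ball 0 2)) := by
    intro j _ x _
    simp only [fun y => iteratedFDeriv_smul_const_of_contDiff (hdiff j y) (g y) x,
      fun y => iteratedFDeriv_rescale (hΨ j) r x y]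
    refine ContinuousLinearMap.aestronglyMeasurable_comp₂ _
      (((ContinuousLinearMap.lsmul ℝ ℝ : ℝ →L[ℝ] V →L[ℝ] V).flip.continuous.comp_aestronglyMeasurable
        hgm)) ?_
    have := (hΨ j).continuous_iteratedFDeriv le_rfl
    exact (by fun_prop : Continuous fun y => (r ^ n * r ^ j) •
      iteratedFDeriv ℝ j Ψ (r • (x - y))).aestronglyMeasurable
  have hint : ∀ j ≤ m, Integrable (fun _ : Euc n => |r ^ n * r ^ j| * D j * B)
      (volume.restrict (Metric.ball 0 2)) := fun j _ =>
    integrableOn_const measure_ball_lt_top.ne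
  have hbound : ∀ j ≤ m, ∀ᵐ y ∂(volume.restrict (Metric.ball (0 : Euc n) 2)),
      ∀ x ∈ (Set.univ : Set (Euc n)),
      ‖iteratedFDeriv ℝ j (fun x => (r ^ n * Ψ (r • (x - y))) • g y) x‖ ≤
        |r ^ n * r ^ j| * D j * B := by
    intro j _
    refine (ae_restrict_mem Metric.isOpen_ball.measurableSet).mono fun y hy x _ => ?_
    refine (norm_iteratedFDeriv_smul_const_le (hdiff j y) (g y) x).trans ?_
    rw [iteratedFDeriv_rescale (hΨ j), norm_smul, norm_eq_abs]
    have := hD0 j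
    gcongr
    · exact hD j _
    · exact hg y hy
  exact ⟨contDiffOn_univ.1 (contDiffOn_integral isOpen_univ hf hmeas hint hbound), fun x =>
    iteratedFDeriv_integral isOpen_univ hf hmeas hint hbound le_rfl (Set.mem_univ x)⟩

theorem norm_iteratedFDeriv_kernelLayer_le [CompleteSpace V] {Ψ : Euc n → ℝ} (hΨ : ∀ m : ℕ, ContDiff ℝ m Ψ)
    (hΨ0 : ∀ x, 1 / 2 ≤ ‖x‖ → Ψ x = 0) {r : ℝ} (hr : 0 < r) {g : Euc n → V} {B B' : ℝ}
    (hgm : AEStronglyMeasurable g (volume.restrict (Metric.ball 0 2)))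
    (hg : ∀ y ∈ Metric.ball (0 : Euc n) 2, ‖g y‖ ≤ B) (m : ℕ) {x : Euc n} (hB' : 0 ≤ B')
    (hg' : ∀ y ∈ Metric.ball (0 : Euc n) 2, ‖x - y‖ ≤ r⁻¹ → ‖g y‖ ≤ B') :
    ‖iteratedFDeriv ℝ m (kernelLayer Ψ r g) x‖ ≤
      r ^ m * (∫ z, ‖iteratedFDeriv ℝ m Ψ z‖) * B' := by
  rw [(contDiff_kernelLayer hΨ hΨ0 r hgm hg m).2]
  have hΨc : HasCompactSupport Ψ := by
    refine HasCompactSupport.intro (isCompact_closedBall (0 : Euc n) (1 / 2)) fun x hx => hΨ0 x ?_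
    rw [mem_closedBall_zero_iff, not_le] at hx
    exact hx.le
  have hcont := (hΨ m).continuous_iteratedFDeriv le_rfl
  have hI : Integrable (fun z => ‖iteratedFDeriv ℝ m Ψ z‖) :=
    (hcont.integrable_of_hasCompactSupport (hΨc.iteratedFDeriv m)).norm
  have hI2 : Integrable (fun y => r ^ n * r ^ m * ‖iteratedFDeriv ℝ m Ψ (r • (x - y))‖ * B') :=
    (((hI.comp_smul hr.ne').comp_sub_left x).const_mul _).mul_const _
  have heq : ∫ y, r ^ n * r ^ m * ‖iteratedFDeriv ℝ m Ψ (r • (x - y))‖ * B' =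
      r ^ m * (∫ z, ‖iteratedFDeriv ℝ m Ψ z‖) * B' := by
    rw [integral_mul_const, integral_const_mul,
      integral_sub_left_eq_self (fun y => ‖iteratedFDeriv ℝ m Ψ (r • y)‖) volume x,
      Measure.integral_comp_smul_of_nonneg volume (fun y => ‖iteratedFDeriv ℝ m Ψ y‖) r (hR := hr.le)]
    rw [finrank_euclideanSpace, Fintype.card_fin, smul_eq_mul]
    field_simp
  rw [← heq]
  refine (norm_integral_le_of_norm_le hI2.integrableOn ?_).trans
    (setIntegral_le_integral hI2 (Eventually.of_forall fun y => by positivity))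
  refine (ae_restrict_mem Metric.isOpen_ball.measurableSet).mono fun y hy => ?_
  have hdiff : ContDiff ℝ m (fun x => r ^ n * Ψ (r • (x - y))) := by
    have := hΨ m
    fun_prop
  refine (norm_iteratedFDeriv_smul_const_le hdiff (g y) x).trans ?_
  rw [iteratedFDeriv_rescale (hΨ m), norm_smul, norm_of_nonneg (by positivity)]
  rcases le_or_gt ‖x - y‖ r⁻¹ with h | h
  · gcongr
    exact hg' y hy h
  · rw [iteratedFDeriv_eq_zero_of_half_lt hΨ0 m]
    · simp
    · rw [norm_smul, norm_of_nonneg hr.le]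
      have : r * r⁻¹ < r * ‖x - y‖ := by gcongr
      rw [mul_inv_cancel₀ hr.ne'] at this
      linarith

theorem kernelLayer_eq_integral_comp {Ψ : Euc n → ℝ} (hΨ0 : ∀ x, 1 / 2 ≤ ‖x‖ → Ψ x = 0) {r : ℝ}
    (hr : 1 ≤ r) (g : Euc n → V) {x : Euc n} (hx : x ∈ Metric.ball (0 : Euc n) 1) :
    kernelLayer Ψ r g x = ∫ z in Metric.closedBall 0 (1 / 2), Ψ z • g (x - r⁻¹ • z) := by
  have hr0 : 0 < r := by linarith
  have h1 : kernelLayer Ψ r g x = ∫ y, (r ^ n * Ψ (r • (x - y))) • g y := by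
    refine setIntegral_eq_integral_of_forall_compl_eq_zero fun y hy => ?_
    rw [hΨ0, mul_zero, zero_smul]
    rw [mem_ball_zero_iff] at hx hy
    rw [norm_smul, norm_of_nonneg hr0.le]
    have := norm_sub_norm_le y x
    rw [norm_sub_rev] at this
    nlinarith
  have h2 : ∫ z in Metric.closedBall 0 (1 / 2), Ψ z • g (x - r⁻¹ • z) =
      ∫ z, Ψ z • g (x - r⁻¹ • z) := by
    refine setIntegral_eq_integral_of_forall_compl_eq_zero fun z hz => ?_
    rw [mem_closedBall_zero_iff, not_le] at hz
    rw [hΨ0 z hz.le, zero_smul]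
  have h3 := Measure.integral_comp_smul_of_nonneg (volume : Measure (Euc n))
    (fun z => Ψ z • g (x - r⁻¹ • z)) r (hR := hr0.le)
  simp only [smul_smul, inv_mul_cancel₀ hr0.ne', one_smul, finrank_euclideanSpace,
    Fintype.card_fin] at h3
  rw [h1, h2, ← integral_sub_left_eq_self _ volume x]
  simp only [sub_sub_cancel, mul_smul]
  rw [integral_smul, h3, smul_smul, mul_inv_cancel₀ (by positivity), one_smul]

theorem sub_inv_smul_mem_ball {r : ℝ} (hr : 1 ≤ r) {x z : Euc n} (hx : x ∈ Metric.ball (0 : Euc n) 1)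
    (hz : z ∈ Metric.closedBall (0 : Euc n) (1 / 2)) :
    x - r⁻¹ • z ∈ Metric.ball (0 : Euc n) 2 := by
  rw [mem_ball_zero_iff] at hx ⊢
  rw [mem_closedBall_zero_iff] at hz
  have h1 := norm_sub_le x (r⁻¹ • z)
  rw [norm_smul, norm_of_nonneg (by positivity)] at h1
  have : r⁻¹ ≤ 1 := inv_le_one_of_one_le₀ hr
  nlinarith [norm_nonneg z]

end KernelLayer

section LayerBounds

variable {n : ℕ}

theorem continuousOn_iteratedFDeriv_of_isOpen {s : Set (Euc n)} (hs : IsOpen s) {k j : ℕ}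
    {f : Euc n → ℝ} (hf : ContDiffOn ℝ k f s) (hj : j ≤ k) :
    ContinuousOn (iteratedFDeriv ℝ j f) s :=
  (hf.continuousOn_iteratedFDerivWithin (by exact_mod_cast hj) hs.uniqueDiffOn).congr
    fun _ hx => (iteratedFDerivWithin_of_isOpen j hs hx).symm

theorem continuousOn_comp_sub_inv_smul {V : Type} [NormedAddCommGroup V] {g : Euc n → V}
    (hg : ContinuousOn g (Metric.ball 0 2)) {r : ℝ} (hr : 1 ≤ r) {x : Euc n}
    (hx : x ∈ Metric.ball (0 : Euc n) 1) :
    ContinuousOn (fun z => g (x - r⁻¹ • z)) (Metric.closedBall 0 (1 / 2)) :=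
  hg.comp (by fun_prop) fun _ hz => sub_inv_smul_mem_ball hr hx hz

theorem iteratedFDeriv_kernelLayer {Ψ : Euc n → ℝ} (hΨ : Continuous Ψ)
    (hΨ0 : ∀ x, 1 / 2 ≤ ‖x‖ → Ψ x = 0) {r : ℝ} (hr : 1 ≤ r) {k : ℕ} {f : Euc n → ℝ}
    (hf : ContDiffOn ℝ k f (Metric.ball 0 2)) {M : ℝ}
    (hM : ∀ j ≤ k, ∀ y ∈ Metric.ball (0 : Euc n) 2, ‖iteratedFDeriv ℝ j f y‖ ≤ M) {j : ℕ}
    (hj : j ≤ k) {x : Euc n} (hx : x ∈ Metric.ball (0 : Euc n) 1) :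
    iteratedFDeriv ℝ j (kernelLayer Ψ r f) x = kernelLayer Ψ r (iteratedFDeriv ℝ j f) x := by
  have h1 : kernelLayer Ψ r f =ᶠ[nhds x]
      fun x => ∫ z in Metric.closedBall 0 (1 / 2), Ψ z • f (x - r⁻¹ • z) := by
    filter_upwards [Metric.isOpen_ball.mem_nhds hx] with x hx
    exact kernelLayer_eq_integral_comp hΨ0 hr f hx
  rw [(h1.iteratedFDeriv ℝ j).eq_of_nhds, kernelLayer_eq_integral_comp hΨ0 hr _ hx]
  have hcase : ∀ z : Euc n, z ∈ Metric.closedBall (0 : Euc n) (1 / 2) ∨ Ψ z = 0 := fun z => by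
    rw [mem_closedBall_zero_iff]
    exact (le_or_gt ‖z‖ (1 / 2)).imp_right fun h => hΨ0 z h.le
  have hderiv : ∀ j ≤ k, ∀ x ∈ Metric.ball (0 : Euc n) 1, ∀ z : Euc n,
      iteratedFDeriv ℝ j (fun x => Ψ z • f (x - r⁻¹ • z)) x =
        Ψ z • iteratedFDeriv ℝ j f (x - r⁻¹ • z) := by
    intro j hj x hx z
    rcases hcase z with hz | hz
    · have hfa : ContDiffAt ℝ j f (x - r⁻¹ • z) :=
        (hf.contDiffAt (Metric.isOpen_ball.mem_nhds (sub_inv_smul_mem_ball hr hx hz))).of_le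
          (by exact_mod_cast hj)
      have hfa' : ContDiffAt ℝ j (fun x => f (x - r⁻¹ • z)) x :=
        ContDiffAt.comp x hfa (by fun_prop)
      rw [iteratedFDeriv_const_smul_apply' hfa', iteratedFDeriv_comp_sub]
    · simp only [hz, zero_smul]
      exact congrFun iteratedFDeriv_fun_zero x
  have hcont : ∀ z, ContDiffOn ℝ k (fun x => Ψ z • f (x - r⁻¹ • z)) (Metric.ball 0 1) := by
    intro z
    rcases hcase z with hz | hz
    · refine ContDiffOn.const_smul _ (hf.comp (by fun_prop) fun x hx => ?_)
      exact sub_inv_smul_mem_ball hr hx hz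
    · simp only [hz, zero_smul]
      exact contDiffOn_const
  have hc := isCompact_closedBall (0 : Euc n) (1 / 2)
  rw [iteratedFDeriv_integral (m := k) (bound := fun _ z => ‖Ψ z‖ * M) Metric.isOpen_ball hcont ?_ ?_ ?_ hj hx]
  · simp only [hderiv j hj x hx]
  · intro j hj x hx
    simp only [hderiv j hj x hx]
    exact (hΨ.continuousOn.smul (continuousOn_comp_sub_inv_smul
      (continuousOn_iteratedFDeriv_of_isOpen Metric.isOpen_ball hf hj) hr hx)).aestronglyMeasurable
      hc.isClosed.measurableSet
  · exact fun j _ => (hΨ.norm.continuousOn.integrableOn_compact hc).mul_const M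
  · intro j hj
    refine (ae_restrict_mem hc.isClosed.measurableSet).mono fun z hz x hx => ?_
    rw [hderiv j hj x hx, norm_smul]
    gcongr
    exact hM j hj _ (sub_inv_smul_mem_ball hr hx hz)

theorem iteratedFDeriv_kernelLayer_sub_const {V : Type} [NormedAddCommGroup V] [NormedSpace ℝ V]
    [CompleteSpace V] {Ψ : Euc n → ℝ} (hΨ : ∀ m : ℕ, ContDiff ℝ m Ψ)
    (hΨ0 : ∀ x, 1 / 2 ≤ ‖x‖ → Ψ x = 0) {r : ℝ} (hr : 1 ≤ r) {g : Euc n → V}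
    (hg : ContinuousOn g (Metric.ball 0 2)) {B : ℝ}
    (hB : ∀ y ∈ Metric.ball (0 : Euc n) 2, ‖g y‖ ≤ B) (c : V) {i : ℕ} (hi : i ≠ 0) {x : Euc n}
    (hx : x ∈ Metric.ball (0 : Euc n) 1) :
    iteratedFDeriv ℝ i (kernelLayer Ψ r g) x =
      iteratedFDeriv ℝ i (kernelLayer Ψ r fun y => g y - c) x := by
  have hc := isCompact_closedBall (0 : Euc n) (1 / 2)
  have hgc : ContinuousOn (fun y => g y - c) (Metric.ball 0 2) := hg.sub continuousOn_const
  have h1 : kernelLayer Ψ r g =ᶠ[nhds x] fun x => kernelLayer Ψ r (fun y => g y - c) x +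
      ∫ z in Metric.closedBall 0 (1 / 2), Ψ z • c := by
    filter_upwards [Metric.isOpen_ball.mem_nhds hx] with x hx
    rw [kernelLayer_eq_integral_comp hΨ0 hr _ hx, kernelLayer_eq_integral_comp hΨ0 hr _ hx,
      ← integral_add]
    · simp [smul_sub]
    · exact ((hΨ 0).continuous.continuousOn.smul
        (continuousOn_comp_sub_inv_smul hgc hr hx)).integrableOn_compact hc
    · exact ((hΨ 0).continuous.continuousOn.smul continuousOn_const).integrableOn_compact hc
  have hd := (contDiff_kernelLayer hΨ hΨ0 r (B := B + ‖c‖)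
    (hgc.aestronglyMeasurable Metric.isOpen_ball.measurableSet)
    (fun y hy => (norm_sub_le _ _).trans (by linarith [hB y hy])) i).1
  rw [(h1.iteratedFDeriv ℝ i).eq_of_nhds,
    fun_iteratedFDeriv_add_apply hd.contDiffAt contDiffAt_const, iteratedFDeriv_const_of_ne hi]
  simp

/-- Derivative bounds, uniform in the scale, for the layers of a Hölder function. -/
theorem exists_kernelLayer_bounds {Ψ : Euc n → ℝ} (hΨ : ∀ m : ℕ, ContDiff ℝ m Ψ)
    (hΨ0 : ∀ x, 1 / 2 ≤ ‖x‖ → Ψ x = 0) (k m : ℕ) {α : ℝ} (hα : 0 ≤ α) :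
    ∃ C, 0 ≤ C ∧ ∀ (f : Euc n → ℝ) (M r : ℝ), 0 ≤ M → 1 ≤ r →
      ContDiffOn ℝ k f (Metric.ball 0 2) → HolderBdd n k α (Metric.ball 0 2) f M →
      (∀ j : ℕ, ContDiff ℝ j (kernelLayer Ψ r f)) ∧
      (∀ j ≤ k, ∀ x ∈ Metric.ball (0 : Euc n) 1,
        ‖iteratedFDeriv ℝ j (kernelLayer Ψ r f) x‖ ≤ C * M) ∧
      (∀ i ≤ m, i ≠ 0 → ∀ x ∈ Metric.ball (0 : Euc n) 1,
        ‖iteratedFDeriv ℝ (k + i) (kernelLayer Ψ r f) x‖ ≤ C * M * r⁻¹ ^ (α - i)) ∧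
      ∀ x ∈ Metric.ball (0 : Euc n) 1, ∀ y ∈ Metric.ball (0 : Euc n) 1,
        ‖iteratedFDeriv ℝ k (kernelLayer Ψ r f) x - iteratedFDeriv ℝ k (kernelLayer Ψ r f) y‖ ≤
          C * M * ‖x - y‖ ^ α := by
  obtain ⟨I, hI⟩ : ∃ I : ℕ → ℝ, ∀ i, I i = ∫ z, ‖iteratedFDeriv ℝ i Ψ z‖ := ⟨_, fun _ => rfl⟩
  have hI0 : ∀ i, 0 ≤ I i := fun i => hI i ▸ integral_nonneg fun _ => norm_nonneg _
  obtain ⟨C, hC⟩ : ∃ C, C = ∑ i ∈ Finset.range (m + 1), I i := ⟨_, rfl⟩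
  have hC0 : 0 ≤ C := hC ▸ Finset.sum_nonneg fun i _ => hI0 i
  have hIC : ∀ i ≤ m, I i ≤ C := fun i hi => hC ▸
    Finset.single_le_sum (fun i _ => hI0 i) (Finset.mem_range.2 (by omega))
  refine ⟨C, hC0, fun f M r hM hr hf hfM => ?_⟩
  have hr0 : 0 < r := by linarith
  have hD : ∀ j ≤ k, ∀ y ∈ Metric.ball (0 : Euc n) 2, ‖iteratedFDeriv ℝ j f y‖ ≤ M := by
    intro j hj y hy
    have := hfM.1 j hj y hy
    rwa [iteratedFDerivWithin_of_isOpen j Metric.isOpen_ball hy] at this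
  have hH : ∀ x ∈ Metric.ball (0 : Euc n) 2, ∀ y ∈ Metric.ball (0 : Euc n) 2,
      ‖iteratedFDeriv ℝ k f x - iteratedFDeriv ℝ k f y‖ ≤ M * ‖x - y‖ ^ α := by
    intro x hx y hy
    have := hfM.2 x hx y hy
    rwa [iteratedFDerivWithin_of_isOpen k Metric.isOpen_ball hx,
      iteratedFDerivWithin_of_isOpen k Metric.isOpen_ball hy] at this
  have hcont : ∀ j ≤ k, ContinuousOn (iteratedFDeriv ℝ j f) (Metric.ball 0 2) := fun j hj =>
    continuousOn_iteratedFDeriv_of_isOpen Metric.isOpen_ball hf hj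
  have hms := (Metric.isOpen_ball (x := (0 : Euc n)) (ε := 2)).measurableSet
  have hf0 : ∀ y ∈ Metric.ball (0 : Euc n) 2, ‖f y‖ ≤ M := fun y hy => by
    simpa using hD 0 (Nat.zero_le _) y hy
  have hsmooth : ∀ j : ℕ, ContDiff ℝ j (kernelLayer Ψ r f) := fun j =>
    (contDiff_kernelLayer hΨ hΨ0 r (hf.continuousOn.aestronglyMeasurable hms) hf0 j).1
  have hc := isCompact_closedBall (0 : Euc n) (1 / 2)
  have hIle : ∫ z in Metric.closedBall 0 (1 / 2), ‖Ψ z‖ ≤ C := by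
    refine le_trans ?_ (hIC 0 (Nat.zero_le _))
    rw [hI]
    simp only [norm_iteratedFDeriv_zero]
    refine setIntegral_le_integral ?_ (Eventually.of_forall fun y => norm_nonneg _)
    refine ((hΨ 0).continuous.integrable_of_hasCompactSupport
      (HasCompactSupport.intro hc fun x hx => hΨ0 x ?_)).norm
    rw [mem_closedBall_zero_iff, not_le] at hx
    exact hx.le
  have hΨi : IntegrableOn (fun z => ‖Ψ z‖) (Metric.closedBall 0 (1 / 2)) :=
    (hΨ 0).continuous.norm.continuousOn.integrableOn_compact hc
  refine ⟨hsmooth, fun j hj x hx => ?_, fun i hi hi0 x hx => ?_, fun x hx y hy => ?_⟩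
  · rw [iteratedFDeriv_kernelLayer (hΨ 0).continuous hΨ0 hr hf hD hj hx,
      kernelLayer_eq_integral_comp hΨ0 hr _ hx]
    calc _ ≤ ∫ z in Metric.closedBall 0 (1 / 2), ‖Ψ z‖ * M := by
          refine norm_integral_le_of_norm_le (hΨi.mul_const M)
            ((ae_restrict_mem hc.isClosed.measurableSet).mono fun z hz => ?_)
          rw [norm_smul]
          gcongr
          exact hD j hj _ (sub_inv_smul_mem_ball hr hx hz)
      _ ≤ C * M := by
          rw [integral_mul_const]
          gcongr
  · rw [← norm_iteratedFDeriv_iteratedFDeriv]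
    have h1 : iteratedFDeriv ℝ k (kernelLayer Ψ r f) =ᶠ[nhds x]
        kernelLayer Ψ r (iteratedFDeriv ℝ k f) := by
      filter_upwards [Metric.isOpen_ball.mem_nhds hx] with x hx
      exact iteratedFDeriv_kernelLayer (hΨ 0).continuous hΨ0 hr hf hD le_rfl hx
    have hx2 : x ∈ Metric.ball (0 : Euc n) 2 := Metric.ball_subset_ball (by norm_num) hx
    rw [(h1.iteratedFDeriv ℝ i).eq_of_nhds, iteratedFDeriv_kernelLayer_sub_const hΨ hΨ0 hr
      (hcont k le_rfl) (hD k le_rfl) (iteratedFDeriv ℝ k f x) hi0 hx]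
    refine (norm_iteratedFDeriv_kernelLayer_le hΨ hΨ0 hr0 (B := M + M) (B' := M * r⁻¹ ^ α)
      (((hcont k le_rfl).sub continuousOn_const).aestronglyMeasurable hms) (fun y hy => ?_) i
      (by positivity) fun y hy hxy => ?_).trans ?_
    · exact (norm_sub_le _ _).trans (add_le_add (hD k le_rfl y hy) (hD k le_rfl x hx2))
    · refine (hH y hy x hx2).trans ?_
      rw [norm_sub_rev]
      gcongr
    · rw [← hI, rpow_sub (by positivity), rpow_natCast, inv_pow]
      calc _ ≤ r ^ i * C * (M * r⁻¹ ^ α) := by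
            gcongr
            exact hIC i hi
        _ = _ := by field_simp
  · rw [iteratedFDeriv_kernelLayer (hΨ 0).continuous hΨ0 hr hf hD le_rfl hx,
      iteratedFDeriv_kernelLayer (hΨ 0).continuous hΨ0 hr hf hD le_rfl hy,
      kernelLayer_eq_integral_comp hΨ0 hr _ hx, kernelLayer_eq_integral_comp hΨ0 hr _ hy,
      ← integral_sub]
    · calc _ ≤ ∫ z in Metric.closedBall 0 (1 / 2), ‖Ψ z‖ * (M * ‖x - y‖ ^ α) := by
            refine norm_integral_le_of_norm_le (hΨi.mul_const _)
              ((ae_restrict_mem hc.isClosed.measurableSet).mono fun z hz => ?_)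
            rw [← smul_sub, norm_smul]
            gcongr
            refine (hH _ (sub_inv_smul_mem_ball hr hx hz) _
              (sub_inv_smul_mem_ball hr hy hz)).trans_eq ?_
            rw [sub_sub_sub_cancel_right]
        _ ≤ C * (M * ‖x - y‖ ^ α) := by
            rw [integral_mul_const]
            gcongr
        _ = _ := by ring
    · exact ((hΨ 0).continuous.continuousOn.smul
        (continuousOn_comp_sub_inv_smul (hcont k le_rfl) hr hx)).integrableOn_compact hc
    · exact ((hΨ 0).continuous.continuousOn.smul
        (continuousOn_comp_sub_inv_smul (hcont k le_rfl) hr hy)).integrableOn_compact hc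

end LayerBounds

section Assembly

variable {n : ℕ}

theorem norm_iteratedFDeriv_sub_le_of_norm_le {s : Set (Euc n)} (hs : IsOpen s) (hsc : Convex ℝ s)
    {m : ℕ} {f : Euc n → ℝ} (hf : ContDiffOn ℝ (m + 1 : ℕ) f s) {B : ℝ}
    (hB : ∀ x ∈ s, ‖iteratedFDeriv ℝ (m + 1) f x‖ ≤ B) {x y : Euc n} (hx : x ∈ s) (hy : y ∈ s) :
    ‖iteratedFDeriv ℝ m f x - iteratedFDeriv ℝ m f y‖ ≤ B * ‖x - y‖ := by
  refine hsc.norm_image_sub_le_of_norm_fderiv_le (𝕜 := ℝ) (fun z hz => ?_) (fun z hz => ?_) hy hx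
  · exact (hf.contDiffAt (hs.mem_nhds hz)).differentiableAt_iteratedFDeriv
      (by exact_mod_cast Nat.lt_succ_self m)
  · rw [norm_fderiv_iteratedFDeriv]
    exact hB z hz

theorem exists_dyadicAvg_zero_bounds (hn : 1 ≤ n) {σ : ℝ} (hσ : σ ∈ Set.Ioo (0 : ℝ) 1) (m : ℕ) :
    ∃ C, 0 ≤ C ∧ ∀ u : Euc n → ℝ, MemLσ n σ u →
      ContDiffOn ℝ m (dyadicAvg n σ u 0) (Metric.ball 0 1) ∧
      ∀ j ≤ m, ∀ x ∈ Metric.ball (0 : Euc n) 1, ‖iteratedFDeriv ℝ j (dyadicAvg n σ u 0) x‖ ≤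
        C * ∫ x, |u x| / (1 + ‖x‖ ^ ((n : ℝ) + 2 * σ)) := by
  have hp : 0 < (n : ℝ) + 2 * σ := by have := hσ.1; positivity
  choose D hD0 hD using exists_norm_iteratedFDeriv_avgKernel_le (n := n) hn hσ
  have hK : ∀ j : ℕ, ContDiff ℝ j (avgKernel n σ) := fun j => (contDiff_avgKernel hn hσ j).1
  obtain ⟨C, hC⟩ : ∃ C, C = ∑ j ∈ Finset.range (m + 1), D j := ⟨_, rfl⟩
  have hC0 : 0 ≤ C := hC ▸ Finset.sum_nonneg fun j _ => hD0 j
  have hDC : ∀ j ≤ m, D j ≤ C := fun j hj => hC ▸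
    Finset.single_le_sum (fun j _ => hD0 j) (Finset.mem_range.2 (by omega))
  refine ⟨C * 2 ^ ((n : ℝ) + 2 * σ) * 2, by positivity, fun u hu => ?_⟩
  obtain ⟨hwi, hwle⟩ := hu.integrable_weight hσ
  have hU : dyadicAvg n σ u 0 = fun x => ∫ y, u y * avgKernel n σ (x - y) := by
    ext x
    simp [dyadicAvg]
  rw [hU]
  have hderiv : ∀ (j : ℕ) (x y : Euc n), iteratedFDeriv ℝ j (fun x => u y * avgKernel n σ (x - y)) x =
      u y • iteratedFDeriv ℝ j (avgKernel n σ) (x - y) := by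
    intro j x y
    have h1 : ContDiff ℝ j fun x => avgKernel n σ (x - y) := by
      have := hK j
      fun_prop
    have h2 := iteratedFDeriv_const_smul_apply' (𝕜 := ℝ) (i := j) (a := u y) (x := x) h1.contDiffAt
    simp only [smul_eq_mul] at h2
    rw [h2, iteratedFDeriv_comp_sub]
  have hcd : ∀ y, ContDiffOn ℝ m (fun x => u y * avgKernel n σ (x - y)) (Metric.ball 0 1) := by
    intro y
    have := hK m
    exact ContDiff.contDiffOn (by fun_prop)
  have hmeas : ∀ j ≤ m, ∀ x ∈ Metric.ball (0 : Euc n) 1, AEStronglyMeasurable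
      (fun y => iteratedFDeriv ℝ j (fun x => u y * avgKernel n σ (x - y)) x) := by
    intro j _ x _
    simp only [hderiv]
    have := (hK j).continuous_iteratedFDeriv le_rfl
    exact hu.1.aestronglyMeasurable.smul (by fun_prop : Continuous fun y =>
      iteratedFDeriv ℝ j (avgKernel n σ) (x - y)).aestronglyMeasurable
  have hbd : ∀ j ≤ m, ∀ y, ∀ x ∈ Metric.ball (0 : Euc n) 1,
      ‖iteratedFDeriv ℝ j (fun x => u y * avgKernel n σ (x - y)) x‖ ≤
        C * 2 ^ ((n : ℝ) + 2 * σ) * (|u y| * (1 + ‖y‖) ^ (-((n : ℝ) + 2 * σ))) := by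
    intro j hj y x hx
    rw [hderiv, norm_smul, norm_eq_abs]
    have h1 := one_add_norm_smul_sub_rpow_neg_le hp le_rfl (mem_ball_zero_iff.1 hx).le y
    rw [one_smul] at h1
    calc _ ≤ |u y| * (C * (2 ^ ((n : ℝ) + 2 * σ) * (1 + ‖y‖) ^ (-((n : ℝ) + 2 * σ)))) := by
          gcongr
          refine (hD j _).trans ?_
          gcongr
          exact hDC j hj
      _ = _ := by ring
  have hint : ∀ j ≤ m, Integrable fun y =>
      C * 2 ^ ((n : ℝ) + 2 * σ) * (|u y| * (1 + ‖y‖) ^ (-((n : ℝ) + 2 * σ))) := fun j _ =>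
    hwi.const_mul _
  have hbd' := fun j hj => Eventually.of_forall (f := ae (volume : Measure (Euc n))) (hbd j hj)
  refine ⟨contDiffOn_integral Metric.isOpen_ball hcd hmeas hint hbd', fun j hj x hx => ?_⟩
  rw [iteratedFDeriv_integral Metric.isOpen_ball hcd hmeas hint hbd' hj hx]
  calc _ ≤ ∫ y, C * 2 ^ ((n : ℝ) + 2 * σ) * (|u y| * (1 + ‖y‖) ^ (-((n : ℝ) + 2 * σ))) :=
        norm_integral_le_of_norm_le (hint j hj)
          (Eventually.of_forall fun y => hbd j hj y x hx)
    _ ≤ C * 2 ^ ((n : ℝ) + 2 * σ) * (2 * ∫ x, |u x| / (1 + ‖x‖ ^ ((n : ℝ) + 2 * σ))) := by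
        rw [integral_const_mul]
        gcongr
    _ = _ := by ring

theorem integral_count_eq_tsum {V : Type} [NormedAddCommGroup V] [NormedSpace ℝ V] [CompleteSpace V]
    {g : ℕ → V} (hg : Summable fun j => ‖g j‖) : ∫ j, g j ∂Measure.count = ∑' j, g j := by
  rw [integral_countable (integrable_count_iff.2 hg)]
  simp

theorem summable_inv_two_pow_rpow {b : ℝ} (hb : 0 < b) :
    Summable fun j : ℕ => ((2 : ℝ) ^ j)⁻¹ ^ b := by
  have h : (fun j : ℕ => ((2 : ℝ) ^ j)⁻¹ ^ b) = fun j : ℕ => ((2 : ℝ)⁻¹ ^ b) ^ j := by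
    ext j
    rw [← inv_pow, ← rpow_natCast, ← rpow_mul (by norm_num), mul_comm, rpow_mul (by norm_num),
      rpow_natCast]
  rw [h]
  exact summable_geometric_of_lt_one (by positivity) (rpow_lt_one (by norm_num) (by norm_num) hb)

end Assembly

section Series

variable {n : ℕ}

theorem exists_dyadic_series_bounds {σ α : ℝ} (hσ : 0 < σ) (k : ℕ) {N : ℕ}
    (hN1 : (N : ℝ) < α + 2 * σ) (hN2 : α + 2 * σ < N + 1) :
    ∃ C, 0 ≤ C ∧ ∀ (w : ℕ → Euc n → ℝ) (K : ℝ), 0 ≤ K →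
      (∀ (j m : ℕ), ContDiff ℝ m (w j)) →
      (∀ j, ∀ i ≤ k, ∀ x ∈ Metric.ball (0 : Euc n) 1, ‖iteratedFDeriv ℝ i (w j) x‖ ≤ K) →
      (∀ j, ∀ i ≤ N + 1, i ≠ 0 → ∀ x ∈ Metric.ball (0 : Euc n) 1,
        ‖iteratedFDeriv ℝ (k + i) (w j) x‖ ≤ K * ((2 : ℝ) ^ j)⁻¹ ^ (α - i)) →
      (∀ j, ∀ x ∈ Metric.ball (0 : Euc n) 1, ∀ y ∈ Metric.ball (0 : Euc n) 1,
        ‖iteratedFDeriv ℝ k (w j) x - iteratedFDeriv ℝ k (w j) y‖ ≤ K * ‖x - y‖ ^ α) →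
      (∀ x ∈ Metric.ball (0 : Euc n) 1, ∀ j,
        ‖((2 : ℝ) ^ j)⁻¹ ^ (2 * σ) * w j x‖ ≤ K * ((2 : ℝ) ^ j)⁻¹ ^ (2 * σ)) ∧
      ContDiffOn ℝ (k + N : ℕ) (fun x => ∑' j, ((2 : ℝ) ^ j)⁻¹ ^ (2 * σ) * w j x)
        (Metric.ball 0 1) ∧
      (∀ i ≤ k + N, ∀ x ∈ Metric.ball (0 : Euc n) 1,
        ‖iteratedFDeriv ℝ i (fun x => ∑' j, ((2 : ℝ) ^ j)⁻¹ ^ (2 * σ) * w j x) x‖ ≤ C * K) ∧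
      ∀ x ∈ Metric.ball (0 : Euc n) 1, ∀ y ∈ Metric.ball (0 : Euc n) 1,
        ‖iteratedFDeriv ℝ (k + N) (fun x => ∑' j, ((2 : ℝ) ^ j)⁻¹ ^ (2 * σ) * w j x) x -
          iteratedFDeriv ℝ (k + N) (fun x => ∑' j, ((2 : ℝ) ^ j)⁻¹ ^ (2 * σ) * w j x) y‖ ≤
          C * K * ‖x - y‖ ^ (α + 2 * σ - N) := by
  obtain ⟨β, hβ⟩ : ∃ β, β = α + 2 * σ - N := ⟨_, rfl⟩
  have hβ0 : 0 < β := by linarith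
  obtain ⟨b, hb⟩ : ∃ b, b = min (2 * σ) β := ⟨_, rfl⟩
  have hb0 : 0 < b := by rw [hb]; exact lt_min (by linarith) hβ0
  have hbσ : b ≤ 2 * σ := hb ▸ min_le_left _ _
  have hbβ : b ≤ β := hb ▸ min_le_right _ _
  obtain ⟨a, ha⟩ : ∃ a, a = if N = 0 then 2 * σ else β := ⟨_, rfl⟩
  have ha0 : 0 < a := by rw [ha]; split_ifs <;> linarith
  obtain ⟨C₁, hC₁, hsumle⟩ := exists_tsum_le_rpow ha0 (show β < 1 by linarith)
  obtain ⟨S, hS⟩ : ∃ S, S = ∑' j : ℕ, ((2 : ℝ) ^ j)⁻¹ ^ b := ⟨_, rfl⟩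
  have hSs := summable_inv_two_pow_rpow hb0
  have hS0 : 0 ≤ S := hS ▸ tsum_nonneg fun j => by positivity
  refine ⟨S + 2 * C₁, by positivity, fun w K hK hw h1 h2 h3 => ?_⟩
  obtain ⟨T, hT⟩ : ∃ T : ℕ → Euc n → ℝ, ∀ j, T j = fun x => ((2 : ℝ) ^ j)⁻¹ ^ (2 * σ) * w j x :=
    ⟨_, fun _ => rfl⟩
  have hTx : ∀ j x, ((2 : ℝ) ^ j)⁻¹ ^ (2 * σ) * w j x = T j x := fun j x => by rw [hT]
  have hTd : ∀ j (m : ℕ) x, iteratedFDeriv ℝ m (T j) x =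
      ((2 : ℝ) ^ j)⁻¹ ^ (2 * σ) • iteratedFDeriv ℝ m (w j) x := fun j m x => by
    rw [hT]
    exact iteratedFDeriv_const_smul_apply' (𝕜 := ℝ) (a := ((2 : ℝ) ^ j)⁻¹ ^ (2 * σ))
      (hw j m).contDiffAt
  have hTcd : ∀ j (m : ℕ), ContDiff ℝ m (T j) := fun j m => by
    have := hw j m
    rw [hT]
    fun_prop
  have hr0 : ∀ j : ℕ, (0 : ℝ) < ((2 : ℝ) ^ j)⁻¹ := fun j => by positivity
  have hr1 : ∀ j : ℕ, ((2 : ℝ) ^ j)⁻¹ ≤ 1 := fun j => inv_le_one_of_one_le₀ (one_le_pow₀ one_le_two)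
  have hlow : ∀ j, ∀ i ≤ k, ∀ x ∈ Metric.ball (0 : Euc n) 1,
      ‖iteratedFDeriv ℝ i (T j) x‖ ≤ K * ((2 : ℝ) ^ j)⁻¹ ^ (2 * σ) := by
    intro j i hi x hx
    rw [hTd, norm_smul, norm_of_nonneg (by positivity), mul_comm]
    gcongr
    exact h1 j i hi x hx
  have hhigh : ∀ j, ∀ i ≤ N + 1, i ≠ 0 → ∀ x ∈ Metric.ball (0 : Euc n) 1,
      ‖iteratedFDeriv ℝ (k + i) (T j) x‖ ≤ K * ((2 : ℝ) ^ j)⁻¹ ^ (β + N - i) := by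
    intro j i hi hi0 x hx
    rw [hTd, norm_smul, norm_of_nonneg (by positivity)]
    calc _ ≤ ((2 : ℝ) ^ j)⁻¹ ^ (2 * σ) * (K * ((2 : ℝ) ^ j)⁻¹ ^ (α - i)) := by
          gcongr
          exact h2 j i hi hi0 x hx
      _ = K * (((2 : ℝ) ^ j)⁻¹ ^ (2 * σ) * ((2 : ℝ) ^ j)⁻¹ ^ (α - i)) := by ring
      _ = _ := by
          rw [← rpow_add (hr0 j), hβ]
          congr 2
          ring
  have hall : ∀ j, ∀ i ≤ k + N, ∀ x ∈ Metric.ball (0 : Euc n) 1,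
      ‖iteratedFDeriv ℝ i (T j) x‖ ≤ K * ((2 : ℝ) ^ j)⁻¹ ^ b := by
    intro j i hi x hx
    rcases le_or_gt i k with hik | hik
    · refine (hlow j i hik x hx).trans ?_
      exact mul_le_mul_of_nonneg_left (rpow_le_rpow_of_exponent_ge (hr0 j) (hr1 j) hbσ) hK
    · obtain ⟨l, rfl⟩ := Nat.exists_eq_add_of_lt hik
      have hl : l + 1 ≤ N := by omega
      refine (hhigh j (l + 1) (by omega) (by omega) x hx).trans ?_
      refine mul_le_mul_of_nonneg_left (rpow_le_rpow_of_exponent_ge (hr0 j) (hr1 j) ?_) hK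
      have : ((l + 1 : ℕ) : ℝ) ≤ N := by exact_mod_cast hl
      linarith
  have hsumn : ∀ i ≤ k + N, ∀ x ∈ Metric.ball (0 : Euc n) 1,
      Summable fun j => ‖iteratedFDeriv ℝ i (T j) x‖ := fun i hi x hx =>
    Summable.of_nonneg_of_le (fun j => norm_nonneg _) (fun j => hall j i hi x hx) (hSs.mul_left K)
  have heq : Set.EqOn (fun x => ∑' j, T j x) (fun x => ∫ j, T j x ∂Measure.count)
      (Metric.ball 0 1) := fun x hx => by
    refine (integral_count_eq_tsum ?_).symm
    simpa only [norm_iteratedFDeriv_zero] using hsumn 0 (Nat.zero_le _) x hx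
  have hint : ∀ i ≤ k + N, Integrable (fun j : ℕ => K * ((2 : ℝ) ^ j)⁻¹ ^ b) Measure.count :=
    fun i _ => integrable_count_iff.2 (hSs.mul_left K).norm
  have hcd := contDiffOn_integral (μ := Measure.count) (m := k + N) Metric.isOpen_ball
    (fun j => (hTcd j (k + N)).contDiffOn) (fun i _ x _ => StronglyMeasurable.of_discrete.aestronglyMeasurable) hint
    (fun i hi => Eventually.of_forall fun j x hx => hall j i hi x hx)
  have hderiv : ∀ i ≤ k + N, ∀ x ∈ Metric.ball (0 : Euc n) 1,
      iteratedFDeriv ℝ i (fun x => ∑' j, T j x) x = ∑' j, iteratedFDeriv ℝ i (T j) x := by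
    intro i hi x hx
    rw [((heq.eventuallyEq_of_mem (Metric.isOpen_ball.mem_nhds hx)).iteratedFDeriv ℝ i).eq_of_nhds,
      iteratedFDeriv_integral (μ := Measure.count) (m := k + N) Metric.isOpen_ball
        (fun j => (hTcd j (k + N)).contDiffOn) (fun i _ x _ => StronglyMeasurable.of_discrete.aestronglyMeasurable) hint
        (fun i hi => Eventually.of_forall fun j x hx => hall j i hi x hx) hi hx,
      integral_count_eq_tsum (hsumn i hi x hx)]
  simp only [hTx]
  refine ⟨fun x hx j => ?_, hcd.congr heq, fun i hi x hx => ?_, fun x hx y hy => ?_⟩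
  · simpa using hlow j 0 (Nat.zero_le _) x hx
  · rw [hderiv i hi x hx]
    refine (tsum_of_norm_bounded (hSs.mul_left K).hasSum fun j => hall j i hi x hx).trans ?_
    rw [tsum_mul_left, ← hS, mul_comm]
    gcongr
    linarith
  · rcases eq_or_ne x y with rfl | hxy
    · simp only [sub_self, norm_zero]
      positivity
    have hd : 0 < ‖x - y‖ := norm_pos_iff.2 (sub_ne_zero.2 hxy)
    rw [hderiv _ le_rfl x hx, hderiv _ le_rfl y hy, ← hβ,
      ← (hsumn _ le_rfl x hx).of_norm.tsum_sub (hsumn _ le_rfl y hy).of_norm]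
    have hb1 : ∀ j, ‖iteratedFDeriv ℝ (k + N) (T j) x - iteratedFDeriv ℝ (k + N) (T j) y‖ ≤
        2 * K * (((2 : ℝ) ^ j)⁻¹ ^ a * ‖x - y‖ ^ (β - a)) := by
      intro j
      rcases Nat.eq_zero_or_pos N with hN | hN
      · subst hN
        have e : β - a = α := by rw [ha, hβ]; simp
        rw [e, ha, if_pos rfl, add_zero, hTd, hTd, ← smul_sub, norm_smul,
          norm_of_nonneg (by positivity)]
        calc _ ≤ ((2 : ℝ) ^ j)⁻¹ ^ (2 * σ) * (K * ‖x - y‖ ^ α) := by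
              gcongr
              exact h3 j x hx y hy
          _ = K * (((2 : ℝ) ^ j)⁻¹ ^ (2 * σ) * ‖x - y‖ ^ α) := by ring
          _ ≤ _ := by
              gcongr
              linarith
      · rw [ha, if_neg hN.ne', sub_self, rpow_zero, mul_one]
        have h4 : ∀ z ∈ Metric.ball (0 : Euc n) 1,
            ‖iteratedFDeriv ℝ (k + N) (T j) z‖ ≤ K * ((2 : ℝ) ^ j)⁻¹ ^ β := fun z hz => by
          have := hhigh j N (by omega) hN.ne' z hz
          rwa [add_sub_cancel_right] at this
        refine (norm_sub_le _ _).trans ?_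
        linarith [h4 x hx, h4 y hy]
    have hb2 : ∀ j, ‖iteratedFDeriv ℝ (k + N) (T j) x - iteratedFDeriv ℝ (k + N) (T j) y‖ ≤
        2 * K * (‖x - y‖ * ((2 : ℝ) ^ j)⁻¹ ^ (β - 1)) := by
      intro j
      have h5 : ∀ z ∈ Metric.ball (0 : Euc n) 1,
          ‖iteratedFDeriv ℝ (k + N + 1) (T j) z‖ ≤ K * ((2 : ℝ) ^ j)⁻¹ ^ (β - 1) := fun z hz => by
        have := hhigh j (N + 1) le_rfl (by omega) z hz
        rw [← add_assoc] at this
        refine this.trans_eq ?_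
        push_cast
        congr 2
        ring
      refine (norm_iteratedFDeriv_sub_le_of_norm_le Metric.isOpen_ball (convex_ball 0 1)
        (hTcd j _).contDiffOn h5 hx hy).trans ?_
      have : 0 ≤ K * (‖x - y‖ * ((2 : ℝ) ^ j)⁻¹ ^ (β - 1)) := by positivity
      linarith
    obtain ⟨hs, hle⟩ := hsumle _ (2 * K) ‖x - y‖ (by positivity) hd (fun j => norm_nonneg _) hb1 hb2
    refine (norm_tsum_le_tsum_norm hs).trans (hle.trans ?_)
    have : C₁ * (2 * K) = 2 * C₁ * K := by ring
    rw [this]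
    gcongr
    linarith

end Series

section Main

variable {n : ℕ} {σ : ℝ}

theorem dyadicLayer_eq_kernelLayer (f : Euc n → ℝ) (j : ℕ) :
    dyadicLayer n σ f j = kernelLayer (stepKernel n σ) (2 ^ j) f := by
  ext x
  simp only [dyadicLayer, kernelLayer, smul_eq_mul, mul_comm]

/-- The limit of the dyadic mollifications is, up to a factor, almost everywhere equal to `u`. -/
theorem ae_eq_of_dyadicAvg (hn : 1 ≤ n) (hσ : σ ∈ Set.Ioo (0 : ℝ) 1) {u f : Euc n → ℝ}
    (hu : MemLσ n σ u)
    (heq : ∀ φ : EuclideanSpace ℝ (Fin n) → ℝ, ContDiff ℝ (⊤ : ℕ∞) φ → HasCompactSupport φ →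
      tsupport φ ⊆ Metric.ball 0 2 → ∫ x, u x * fracLap n σ φ x = ∫ x, f x * φ x)
    {S : Euc n → ℝ} (hS : ∀ x, S x = ∑' j, ((2 : ℝ) ^ j)⁻¹ ^ (2 * σ) * dyadicLayer n σ f j x)
    {W : Euc n → ℝ} (hW : ∀ x, W x = dyadicAvg n σ u 0 x + 2 / fracConst n σ * S x)
    (hWc : ContinuousOn W (Metric.ball 0 1)) {K D : ℝ}
    (hK : ∀ x ∈ Metric.ball (0 : Euc n) 1, ∀ j,
      ‖((2 : ℝ) ^ j)⁻¹ ^ (2 * σ) * dyadicLayer n σ f j x‖ ≤ K * ((2 : ℝ) ^ j)⁻¹ ^ (2 * σ))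
    (hD : ∀ x ∈ Metric.ball (0 : Euc n) 1, ‖dyadicAvg n σ u 0 x‖ ≤ D) :
    ∀ᵐ x : Euc n, x ∈ Metric.ball (0 : Euc n) 1 → u x = (∫ z, avgKernel n σ z)⁻¹ * W x := by
  obtain ⟨A, hA⟩ : ∃ A, A = ∫ z, avgKernel n σ z := ⟨_, rfl⟩
  have hA0 : 0 < A := hA ▸ integral_avgKernel_pos hn hσ
  have hc : 0 < 2 / fracConst n σ := by
    have := fracConst_pos (n := n) hσ
    positivity
  rw [← hA]
  have hAu : LocallyIntegrable (fun x => A * u x) := hu.1.smul A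
  have hsum := summable_inv_two_pow_rpow (b := 2 * σ) (by linarith [hσ.1])
  have hlim : ∀ x ∈ Metric.ball (0 : Euc n) 1,
      Tendsto (fun J => dyadicAvg n σ u J x) atTop (nhds (W x)) := by
    intro x hx
    have h1 := (Summable.of_norm_bounded (hsum.mul_left K) (hK x hx)).hasSum.tendsto_sum_nat
    rw [← hS] at h1
    rw [hW]
    exact ((h1.const_mul (2 / fracConst n σ)).const_add _).congr fun J =>
      (dyadicAvg_eq_sum hn hσ hu heq J hx).symm
  have hbd : ∀ x ∈ Metric.ball (0 : Euc n) 1, ∀ J, ‖dyadicAvg n σ u J x‖ ≤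
      D + 2 / fracConst n σ * ∑' j : ℕ, |K| * ((2 : ℝ) ^ j)⁻¹ ^ (2 * σ) := by
    intro x hx J
    rw [dyadicAvg_eq_sum hn hσ hu heq J hx]
    refine (norm_add_le _ _).trans (add_le_add (hD x hx) ?_)
    rw [norm_mul, norm_of_nonneg hc.le]
    gcongr
    refine (norm_sum_le _ _).trans ((Finset.sum_le_sum fun j _ => (hK x hx j).trans
      (mul_le_mul_of_nonneg_right (le_abs_self K) (by positivity))).trans ?_)
    exact (hsum.mul_left |K|).sum_le_tsum _ fun j _ => by positivity
  have hmain : ∀ᵐ x : Euc n, x ∈ Metric.ball (0 : Euc n) 1 → A * u x - W x = 0 := by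
    refine Metric.isOpen_ball.ae_eq_zero_of_integral_contDiff_smul_eq_zero ?_ fun φ hφ hφc hφs => ?_
    · refine LocallyIntegrableOn.sub ?_ (hWc.locallyIntegrableOn Metric.isOpen_ball.measurableSet)
      exact hAu.locallyIntegrableOn _
    · have hφ1 : Integrable fun x => φ x * (A * u x) := by
        have := hAu.integrable_smul_left_of_hasCompactSupport hφ.continuous hφc
        simpa only [smul_eq_mul] using this
      have hφW : Continuous fun x => φ x * W x := by
        refine (hφ.continuous.continuousOn.mul hWc).continuous_of_tsupport_subset Metric.isOpen_ball
          ((tsupport_mul_subset_left).trans hφs)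
      have hφ2 : Integrable fun x => φ x * W x :=
        hφW.integrable_of_hasCompactSupport hφc.mul_right
      obtain ⟨hi, ht⟩ := tendsto_integral_dyadicAvg_mul hn hσ hu hφ.continuous hφs
      have ht' : Tendsto (fun J => ∫ x, dyadicAvg n σ u J x * φ x) atTop
          (nhds (∫ x, φ x * W x)) := by
        have hcase : ∀ x, x ∈ Metric.ball (0 : Euc n) 1 ∨ φ x = 0 := fun x =>
          (em (x ∈ tsupport φ)).imp (fun h => hφs h) image_eq_zero_of_notMem_tsupport
        refine tendsto_integral_of_dominated_convergence (fun x =>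
          (D + 2 / fracConst n σ * ∑' j : ℕ, |K| * ((2 : ℝ) ^ j)⁻¹ ^ (2 * σ)) * ‖φ x‖)
          (fun J => (hi J).aestronglyMeasurable)
          ((hφ.continuous.integrable_of_hasCompactSupport hφc).norm.const_mul _)
          (fun J => Eventually.of_forall fun x => ?_) (Eventually.of_forall fun x => ?_)
        · rcases hcase x with hx | hx
          · rw [norm_mul]
            gcongr
            exact hbd x hx J
          · simp [hx]
        · rcases hcase x with hx | hx
          · rw [mul_comm (φ x)]
            exact (hlim x hx).mul_const _
          · simp [hx]
      simp only [smul_eq_mul, mul_sub]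
      rw [integral_sub hφ1 hφ2, sub_eq_zero, ← tendsto_nhds_unique ht ht', ← hA]
      congr 1
      ext x
      ring
  filter_upwards [hmain] with x hx hx1
  have := hx hx1
  field_simp
  linarith

end Main

section Assembly

variable {n : ℕ}

theorem norm_iteratedFDeriv_sub_le_rpow_of_bounded {g : Euc n → ℝ} {m : ℕ} {B β : ℝ} (hB : 0 ≤ B)
    (hβ0 : 0 < β) (hβ1 : β < 1) (hg : ContDiffOn ℝ (m + 1 : ℕ) g (Metric.ball 0 1))
    (hgB : ∀ x ∈ Metric.ball (0 : Euc n) 1, ‖iteratedFDeriv ℝ (m + 1) g x‖ ≤ B)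
    {x y : Euc n} (hx : x ∈ Metric.ball (0 : Euc n) 1) (hy : y ∈ Metric.ball (0 : Euc n) 1) :
    ‖iteratedFDeriv ℝ m g x - iteratedFDeriv ℝ m g y‖ ≤ 2 * B * ‖x - y‖ ^ β := by
  have h1 := norm_iteratedFDeriv_sub_le_of_norm_le Metric.isOpen_ball
    (convex_ball (0 : Euc n) 1) hg hgB hx hy
  have h2 : ‖x - y‖ ≤ 2 := by
    rw [mem_ball_zero_iff] at hx hy
    linarith [norm_sub_le x y]
  have h3 : ‖x - y‖ ≤ 2 * ‖x - y‖ ^ β := by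
    rcases (norm_nonneg (x - y)).eq_or_lt with h | h
    · rw [← h, zero_rpow hβ0.ne', mul_zero]
    · calc ‖x - y‖ = ‖x - y‖ ^ (1 - β) * ‖x - y‖ ^ β := by
            rw [← rpow_add h, sub_add_cancel, rpow_one]
        _ ≤ 2 ^ (1 - β) * ‖x - y‖ ^ β := by
            gcongr
        _ ≤ 2 ^ (1 : ℝ) * ‖x - y‖ ^ β := by
            gcongr
            · norm_num
            · linarith
        _ = _ := by rw [rpow_one]
  calc _ ≤ B * ‖x - y‖ := h1
    _ ≤ B * (2 * ‖x - y‖ ^ β) := by gcongr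
    _ = _ := by ring

end Assembly

/-- Theorem 18 (interior Schauder estimate): if `u ∈ L_σ(ℝⁿ)` solves `(−Δ)^σ u = f` in
`B₂(0)` with `f ∈ C^{k,α}(B₂)` (norm bounded by `M`), `α + 2σ` not an integer, then
`u ∈ C^{k,α+2σ}(B₁)` — i.e. `C^{k+⌊α+2σ⌋, α+2σ−⌊α+2σ⌋}(B₁)` — with norm at most
`C(∫ |u|/(1+|x|^{n+2σ}) + M)`, where `C = C(n,σ,k)` is independent of `u` and `f`. -/
theorem interior_schauder_estimate (n : ℕ) (hn : 1 ≤ n) (σ α : ℝ)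
    (hσ : σ ∈ Set.Ioo (0 : ℝ) 1) (hα : α ∈ Set.Ioo (0 : ℝ) 1) (k : ℕ)
    (hni : ∀ m : ℤ, α + 2 * σ ≠ (m : ℝ)) :
    ∃ C : ℝ, 0 < C ∧ ∀ u f : EuclideanSpace ℝ (Fin n) → ℝ,
      MemLσ n σ u →
      ContDiffOn ℝ k f (Metric.ball 0 2) →
      ∀ M : ℝ, 0 ≤ M → HolderBdd n k α (Metric.ball 0 2) f M →
      (∀ φ : EuclideanSpace ℝ (Fin n) → ℝ, ContDiff ℝ (⊤ : ℕ∞) φ → HasCompactSupport φ →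
          tsupport φ ⊆ Metric.ball 0 2 →
          ∫ x, u x * fracLap n σ φ x = ∫ x, f x * φ x) →
      ∃ v : EuclideanSpace ℝ (Fin n) → ℝ,
        ContDiffOn ℝ (k + ⌊α + 2 * σ⌋₊ : ℕ) v (Metric.ball 0 1) ∧
        (∀ᵐ x : EuclideanSpace ℝ (Fin n), x ∈ Metric.ball 0 1 → u x = v x) ∧
        HolderBdd n (k + ⌊α + 2 * σ⌋₊) (α + 2 * σ - ⌊α + 2 * σ⌋₊)
          (Metric.ball (0 : EuclideanSpace ℝ (Fin n)) 1) v
          (C * ((∫ x, |u x| / (1 + ‖x‖ ^ ((n : ℝ) + 2 * σ))) + M)) := by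
  have hα0 := hα.1
  have hσ0 := hσ.1
  obtain ⟨N, hN⟩ : ∃ N, N = ⌊α + 2 * σ⌋₊ := ⟨_, rfl⟩
  have hN1 : (N : ℝ) < α + 2 * σ := by
    refine lt_of_le_of_ne (hN ▸ Nat.floor_le (by positivity)) fun h => hni N ?_
    rw [← h, Int.cast_natCast]
  have hN2 : α + 2 * σ < N + 1 := hN ▸ Nat.lt_floor_add_one _
  rw [← hN]
  obtain ⟨C₁, hC₁, hlayer⟩ := exists_kernelLayer_bounds (n := n) (Ψ := stepKernel n σ)
    contDiff_stepKernel (fun _ => stepKernel_eq_zero) k (N + 1) hα0.le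
  obtain ⟨C₂, hC₂, hseries⟩ := exists_dyadic_series_bounds (n := n) hσ0 k hN1 hN2
  obtain ⟨C₃, hC₃, havg⟩ := exists_dyadicAvg_zero_bounds hn hσ (k + N + 1)
  obtain ⟨A, hA⟩ : ∃ A, A = (∫ z, avgKernel n σ z)⁻¹ := ⟨_, rfl⟩
  have hA0 : 0 < A := hA ▸ inv_pos.2 (integral_avgKernel_pos hn hσ)
  obtain ⟨c, hc⟩ : ∃ c, c = 2 / fracConst n σ := ⟨_, rfl⟩
  have hc0 : 0 < c := hc ▸ div_pos two_pos (fracConst_pos hσ)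
  refine ⟨A * (2 * C₃ + c * (C₂ * C₁)) + 1, by positivity, fun u f hu hf M hM hfM heq => ?_⟩
  obtain ⟨I, hI⟩ : ∃ I, I = ∫ x, |u x| / (1 + ‖x‖ ^ ((n : ℝ) + 2 * σ)) := ⟨_, rfl⟩
  have hI0 : 0 ≤ I := hI ▸ integral_nonneg fun x => by positivity
  have hw := fun j : ℕ => hlayer f M (2 ^ j) hM (one_le_pow₀ one_le_two) hf hfM
  simp only [← dyadicLayer_eq_kernelLayer] at hw
  obtain ⟨hK, hS, hSb, hSh⟩ := hseries (dyadicLayer n σ f) (C₁ * M) (by positivity)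
    (fun j => (hw j).1) (fun j => (hw j).2.1) (fun j => (hw j).2.2.1) (fun j => (hw j).2.2.2)
  obtain ⟨hU, hUb⟩ := havg u hu
  rw [← hI] at hUb ⊢
  obtain ⟨U, hU_eq⟩ : ∃ U, U = dyadicAvg n σ u 0 := ⟨_, rfl⟩
  obtain ⟨S, hS_eq⟩ : ∃ S : Euc n → ℝ,
    S = fun x => ∑' j, ((2 : ℝ) ^ j)⁻¹ ^ (2 * σ) * dyadicLayer n σ f j x := ⟨_, rfl⟩
  rw [← hU_eq] at hU hUb
  rw [← hS_eq] at hS hSb hSh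
  have hU' : ContDiffOn ℝ (k + N : ℕ) U (Metric.ball 0 1) :=
    hU.of_le (by exact_mod_cast (k + N).le_succ)
  have hW : ContDiffOn ℝ (k + N : ℕ) (fun x => U x + c • S x) (Metric.ball 0 1) :=
    hU'.add (hS.const_smul c)
  have hderiv : ∀ j ≤ k + N, ∀ x ∈ Metric.ball (0 : Euc n) 1,
      iteratedFDerivWithin ℝ j (fun x => A • (U x + c • S x)) (Metric.ball 0 1) x =
        A • (iteratedFDeriv ℝ j U x + c • iteratedFDeriv ℝ j S x) := by
    intro j hj x hx
    have hat : ∀ {g : Euc n → ℝ}, ContDiffOn ℝ (k + N : ℕ) g (Metric.ball 0 1) →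
        ContDiffAt ℝ j g x := fun hg =>
      (hg.contDiffAt (Metric.isOpen_ball.mem_nhds hx)).of_le (by exact_mod_cast hj)
    rw [iteratedFDerivWithin_of_isOpen j Metric.isOpen_ball hx,
      iteratedFDeriv_const_smul_apply' (𝕜 := ℝ) (a := A) (hat hW),
      fun_iteratedFDeriv_add_apply (hat hU') (hat (hS.const_smul c)),
      iteratedFDeriv_const_smul_apply' (𝕜 := ℝ) (a := c) (hat hS)]
  refine ⟨fun x => A • (U x + c • S x), hW.const_smul A, ?_, fun j hj x hx => ?_,
    fun x hx y hy => ?_⟩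
  · rw [hA]
    refine ae_eq_of_dyadicAvg hn hσ hu heq (congr_fun hS_eq) (fun x => ?_) hW.continuousOn hK
      (D := C₃ * I) fun x hx => ?_
    · rw [hU_eq, hc, smul_eq_mul]
    · simpa [hU_eq] using hUb 0 (Nat.zero_le _) x hx
  · rw [hderiv j hj x hx, norm_smul, norm_of_nonneg hA0.le]
    have h1 : ‖iteratedFDeriv ℝ j U x + c • iteratedFDeriv ℝ j S x‖ ≤
        C₃ * I + c * (C₂ * (C₁ * M)) := by
      refine (norm_add_le _ _).trans (add_le_add (hUb j (by omega) x hx) ?_)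
      rw [norm_smul, norm_of_nonneg hc0.le]
      gcongr
      exact hSb j hj x hx
    calc _ ≤ A * (C₃ * I + c * (C₂ * (C₁ * M))) := by gcongr
      _ ≤ A * (C₃ * I + c * (C₂ * (C₁ * M))) +
          (A * (C₃ * I + 2 * C₃ * M + c * (C₂ * C₁) * I) + I + M) :=
        le_add_of_nonneg_right (by positivity)
      _ = _ := by ring
  · rw [hderiv _ le_rfl x hx, hderiv _ le_rfl y hy, ← smul_sub, norm_smul,
      norm_of_nonneg hA0.le, add_sub_add_comm, ← smul_sub]
    have h1 := norm_iteratedFDeriv_sub_le_rpow_of_bounded (m := k + N)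
      (mul_nonneg hC₃ hI0) (sub_pos.2 hN1) (by linarith) hU (hUb _ le_rfl) hx hy
    have h2 : ‖iteratedFDeriv ℝ (k + N) U x - iteratedFDeriv ℝ (k + N) U y +
        c • (iteratedFDeriv ℝ (k + N) S x - iteratedFDeriv ℝ (k + N) S y)‖ ≤
        2 * (C₃ * I) * ‖x - y‖ ^ (α + 2 * σ - N) +
          c * (C₂ * (C₁ * M) * ‖x - y‖ ^ (α + 2 * σ - N)) := by
      refine (norm_add_le _ _).trans (add_le_add h1 ?_)
      rw [norm_smul, norm_of_nonneg hc0.le]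
      gcongr
      exact hSh x hx y hy
    calc _ ≤ A * (2 * (C₃ * I) * ‖x - y‖ ^ (α + 2 * σ - N) +
          c * (C₂ * (C₁ * M) * ‖x - y‖ ^ (α + 2 * σ - N))) := by gcongr
      _ ≤ A * (2 * (C₃ * I) * ‖x - y‖ ^ (α + 2 * σ - N) +
          c * (C₂ * (C₁ * M) * ‖x - y‖ ^ (α + 2 * σ - N))) +
          (A * (2 * C₃ * M + c * (C₂ * C₁) * I) + I + M) * ‖x - y‖ ^ (α + 2 * σ - N) :=
        le_add_of_nonneg_right (by positivity)
      _ = _ := by ring
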